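/- arXiv:1901.05329 — 2 statements merged into one kernel-verified Lean document; each statement's English description precedes it below -/
import Mathlib

section
/- For a positive integer n, let A(n) denote the number of partitions of n into distinct parts with no part equal to 1 and with a gap of at least 2 between consecutive parts, let B(n) denote the number of partitions of n into parts congruent to 2 or 3 modulo 5, let C(n) denote the number of partitions of n into distinct parts with no part equal to 1 such that, if o_1 < o_2 < ⋯ are the odd parts listed in ascending order, then for each j neither o_j + 2j − 3 nor o_j + 2j − 1 is a part, and let D(n) denote the number of partitions of n into distinct parts with no part equal to 1 such that, if e_1 < e_2 < ⋯ are the even parts listed in ascending order, then for each j neither e_j + 2j − 1 nor e_j + 2j + 1 is a part. Then A(n) = B(n) = C(n) = D(n). -/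
section

open Finset

/-- `J` is the sequence of reciprocals of the `q`-Pochhammer symbols `(q; q)_n`. -/
structure IsInvPochhammer {R : Type*} [CommRing R] (q : R) (J : ℕ → R) : Prop where
  zero : J 0 = 1
  succ : ∀ n, (1 - q ^ (n + 1)) * J (n + 1) = J n
  ne_zero : ∀ n, 1 - q ^ (n + 1) ≠ 0

namespace IsInvPochhammer

variable {R : Type*} [CommRing R] {q : R} {J : ℕ → R}

/-- Splitting `1 - q ^ (i + j)` as `(1 - q ^ j) + q ^ j * (1 - q ^ i)` gives a `q`-Pascal rule. -/
theorem one_sub_pow_mul_sum (h : IsInvPochhammer q J) (f : ℕ → ℕ → R) (M : ℕ) :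
    (1 - q ^ (M + 1)) * ∑ p ∈ antidiagonal (M + 1), f p.1 p.2 * (J p.1 * J p.2) =
      (∑ p ∈ antidiagonal M, f p.1 (p.2 + 1) * (J p.1 * J p.2)) +
      ∑ p ∈ antidiagonal M, q ^ p.2 * f (p.1 + 1) p.2 * (J p.1 * J p.2) := by
  have key : (1 - q ^ (M + 1)) * ∑ p ∈ antidiagonal (M + 1), f p.1 p.2 * (J p.1 * J p.2) =
      (∑ p ∈ antidiagonal (M + 1), f p.1 p.2 * (J p.1 * ((1 - q ^ p.2) * J p.2))) +
      ∑ p ∈ antidiagonal (M + 1), q ^ p.2 * f p.1 p.2 * (((1 - q ^ p.1) * J p.1) * J p.2) := by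
    rw [mul_sum, ← sum_add_distrib]
    refine sum_congr rfl fun p hp => ?_
    rw [← mem_antidiagonal.mp hp, pow_add]
    ring
  rw [key, Finset.Nat.sum_antidiagonal_succ', Finset.Nat.sum_antidiagonal_succ]
  simp [h.succ]

variable [IsDomain R]

/-- A limiting case of the `q`-Vandermonde convolution. -/
theorem sum_antidiagonal_pow_mul (h : IsInvPochhammer q J) (M : ℕ) : ∀ c : ℕ,
    ∑ p ∈ antidiagonal M, q ^ (p.2 * (p.2 + c)) * J (c + p.2) * (J p.1 * J p.2) =
      J M * J (M + c) := by
  induction M with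
  | zero => intro c; simp [h.zero]
  | succ M ih =>
    intro c
    apply mul_left_cancel₀ (h.ne_zero M)
    rw [h.one_sub_pow_mul_sum (fun _ j => q ^ (j * (j + c)) * J (c + j)), ← mul_assoc, h.succ,
      show M + 1 + c = M + (c + 1) by ring, ← ih, ← sum_add_distrib]
    refine sum_congr rfl fun p _ => ?_
    rw [← h.succ (c + p.2), show c + 1 + p.2 = c + p.2 + 1 by ring,
      show c + (p.2 + 1) = c + p.2 + 1 by ring]
    ring

/-- The `q`-binomial theorem. -/
theorem sum_antidiagonal_choose (h : IsInvPochhammer q J) (x y : R) (M : ℕ) :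
    ∑ p ∈ antidiagonal M,
      (-1) ^ p.1 * q ^ (p.1.choose 2) * x ^ p.1 * y ^ p.2 * (J p.1 * J p.2) =
      J M * ∏ t ∈ range M, (y - x * q ^ t) := by
  induction M with
  | zero => simp [h.zero]
  | succ M ih =>
    apply mul_left_cancel₀ (h.ne_zero M)
    rw [h.one_sub_pow_mul_sum (fun i j => (-1) ^ i * q ^ (i.choose 2) * x ^ i * y ^ j),
      ← mul_assoc, h.succ, prod_range_succ, ← mul_assoc, ← ih, sum_mul, ← sum_add_distrib]
    refine sum_congr rfl fun p hp => ?_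
    rw [← mem_antidiagonal.mp hp, Nat.choose_succ_succ' p.1 1, Nat.choose_one_right]
    ring

end IsInvPochhammer

theorem sum_antidiagonal_two_mul_add_one {R : Type*} [CommRing R] (f : ℕ → ℕ → R) (n : ℕ) :
    ∑ p ∈ antidiagonal (2 * n + 1), f p.1 p.2 =
      ∑ p ∈ antidiagonal n, (f (n + p.1 + 1) p.2 + f p.2 (n + p.1 + 1)) := by
  simp only [Finset.Nat.sum_antidiagonal_eq_sum_range_succ_mk]
  rw [show (2 * n + 1).succ = (n + 1) + (n + 1) by omega, sum_range_add, add_comm, sum_add_distrib]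
  congr 1
  · refine sum_congr rfl fun i hi => ?_
    rw [mem_range] at hi
    congr 1 <;> omega
  · rw [← sum_range_reflect]
    refine sum_congr rfl fun i hi => ?_
    rw [mem_range] at hi
    congr 1; omega

theorem sum_antidiagonal_assoc' {R : Type*} [AddCommMonoid R] (f : ℕ → ℕ → ℕ → R) (n : ℕ)
    (g : ℕ × ℕ → ℕ × ℕ → R)
    (hg : ∀ p : ℕ × ℕ, ∀ r ∈ antidiagonal p.1, g p r = f r.1 r.2 p.2) :
    ∑ p ∈ antidiagonal n, ∑ r ∈ antidiagonal p.1, g p r =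
      ∑ p ∈ antidiagonal n, ∑ r ∈ antidiagonal p.2, f p.1 r.1 r.2 := by
  rw [sum_sigma', sum_sigma']
  refine sum_bij' (fun x _ => ⟨(x.2.1, x.2.2 + x.1.2), (x.2.2, x.1.2)⟩)
    (fun x _ => ⟨(x.1.1 + x.2.1, x.2.2), (x.1.1, x.2.1)⟩) ?_ ?_ ?_ ?_ ?_
  · rintro ⟨⟨a, b⟩, c, d⟩ h
    simp at h ⊢
    omega
  · rintro ⟨⟨a, b⟩, c, d⟩ h
    simp at h ⊢
    omega
  · rintro ⟨⟨a, b⟩, c, d⟩ h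
    simp at h ⊢
    exact h.2
  · rintro ⟨⟨a, b⟩, c, d⟩ h
    simp at h ⊢
    exact h.2
  · rintro ⟨⟨a, b⟩, c, d⟩ h
    simp only [mem_sigma] at h
    exact hg _ _ h.2

namespace IsInvPochhammer

variable {R : Type*} [CommRing R] [IsDomain R] {q : R} {J : ℕ → R}

/-- Iterating step of the Bailey chain relative to `a = q`. -/
theorem bailey_step (h : IsInvPochhammer q J) (α : ℕ → R) (n : ℕ) :
    ∑ p ∈ antidiagonal n, q ^ (p.1 * (p.1 + 1)) * J p.2 *
        ∑ r ∈ antidiagonal p.1, α r.1 * (J r.2 * J (2 * r.1 + r.2 + 1)) =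
      ∑ p ∈ antidiagonal n, q ^ (p.1 * (p.1 + 1)) * α p.1 * (J p.2 * J (2 * p.1 + p.2 + 1)) := by
  simp only [mul_sum]
  rw [sum_antidiagonal_assoc' (fun r s t => q ^ ((r + s) * (r + s + 1)) * J t *
    (α r * (J s * J (2 * r + s + 1)))) n _ fun p r hr => by rw [mem_antidiagonal.mp hr]]
  refine sum_congr rfl fun p _ => ?_
  have hV := h.sum_antidiagonal_pow_mul p.2 (2 * p.1 + 1)
  rw [show 2 * p.1 + p.2 + 1 = p.2 + (2 * p.1 + 1) by ring, ← hV, mul_sum,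
    ← Finset.Nat.sum_antidiagonal_swap]
  refine sum_congr rfl fun r _ => ?_
  rw [show 2 * p.1 + r.swap.1 + 1 = 2 * p.1 + 1 + r.2 by simp; ring]
  simp only [Prod.fst_swap, Prod.snd_swap]
  ring

/-- A finite form of the Jacobi triple product identity. -/
theorem finite_jacobi {u v : R} (h : IsInvPochhammer (u * v) J) (hu : u ≠ 0) (hv : v ≠ 0)
    (n : ℕ) :
    ∑ p ∈ antidiagonal n, (-1) ^ p.1 * ((u * v) ^ (p.1.choose 2) * v ^ p.1 -
        (u * v) ^ ((p.1 + 1).choose 2) * u ^ (p.1 + 1)) * (J p.2 * J (2 * p.1 + p.2 + 1)) =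
      J (2 * n + 1) * ((∏ t ∈ range (n + 1), (1 - (u * v) ^ t * u)) *
        ∏ t ∈ range n, (1 - (u * v) ^ t * v)) := by
  set Q := u * v with hQ
  set y := Q ^ n * u with hy
  have hQ0 : Q ≠ 0 := mul_ne_zero hu hv
  have hK : (-1) ^ (n + 1) * (Q ^ ((n + 1).choose 2) * y ^ n) ≠ 0 :=
    mul_ne_zero (pow_ne_zero _ (by simp)) (mul_ne_zero (pow_ne_zero _ hQ0)
      (pow_ne_zero _ (mul_ne_zero (pow_ne_zero _ hQ0) hu)))
  apply mul_left_cancel₀ hK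
  have hb := h.sum_antidiagonal_choose 1 y (2 * n + 1)
  have hchoose : ∀ a b : ℕ, (a + b).choose 2 = a.choose 2 + b.choose 2 + a * b := by
    intro a b
    induction b with
    | zero => simp
    | succ b ih =>
      rw [← add_assoc, Nat.choose_succ_succ' (a + b) 1, Nat.choose_succ_succ' b 1, ih]
      simp; ring
  rw [sum_antidiagonal_two_mul_add_one
    (fun i j => (-1) ^ i * Q ^ (i.choose 2) * 1 ^ i * y ^ j * (J i * J j))] at hb
  have hprod : ∏ t ∈ range (2 * n + 1), (y - 1 * Q ^ t) =
      (-1) ^ (n + 1) * (Q ^ ((n + 1).choose 2) * y ^ n) *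
      ((∏ t ∈ range (n + 1), (1 - Q ^ t * u)) * ∏ t ∈ range n, (1 - Q ^ t * v)) := by
    rw [show 2 * n + 1 = (n + 1) + n by ring, prod_range_add]
    have hc : ∀ (a : R) (m : ℕ), a ^ m = ∏ _t ∈ range m, a := by simp
    have h1 : ∏ t ∈ range (n + 1), (y - 1 * Q ^ t) =
        (-1) ^ (n + 1) * Q ^ ((n + 1).choose 2) * ∏ t ∈ range (n + 1), (1 - Q ^ t * u) := by
      rw [Nat.choose_two_right, ← Finset.sum_range_id, ← prod_pow_eq_pow_sum,
        ← prod_range_reflect (fun t => 1 - Q ^ t * u), hc, ← prod_mul_distrib, ← prod_mul_distrib]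
      refine prod_congr rfl fun t ht => ?_
      rw [mem_range] at ht
      obtain ⟨s, rfl⟩ : ∃ s, n = t + s := ⟨n - t, by omega⟩
      rw [hy, show t + s + 1 - 1 - t = s by omega, pow_add]
      ring
    have h2 : ∏ t ∈ range n, (y - 1 * Q ^ (n + 1 + t)) =
        y ^ n * ∏ t ∈ range n, (1 - Q ^ t * v) := by
      rw [hc, ← prod_mul_distrib]
      refine prod_congr rfl fun t _ => ?_
      rw [hy, pow_add, pow_succ, hQ]
      ring
    rw [h1, h2]
    ring
  rw [hprod, mul_left_comm] at hb
  rw [← hb, mul_sum]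
  refine sum_congr rfl fun p hp => ?_
  obtain ⟨r, s⟩ := p
  obtain rfl : r + s = n := mem_antidiagonal.mp hp
  have hyv : y * v = Q ^ (r + s + 1) := by rw [hy, hQ]; ring
  have e1 : Q ^ (r + s + r + 1).choose 2 * y ^ s =
      Q ^ (r + s + 1).choose 2 * y ^ (r + s) * (Q ^ r.choose 2 * v ^ r) := by
    rw [show r + s + r + 1 = r + s + 1 + r by ring, hchoose (r + s + 1) r, pow_add _ _ (_ * r),
      pow_mul, ← hyv]
    ring
  have e2 : Q ^ s.choose 2 * y ^ (r + s + r + 1) = Q ^ (r + s + 1).choose 2 * y ^ (r + s) *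
      (Q ^ (r + 1).choose 2 * u ^ (r + 1)) := by
    rw [show r + s + 1 = s + (r + 1) by ring, hchoose s (r + 1),
      show r + s + r + 1 = r + s + (r + 1) by ring, pow_add y, show y ^ (r + 1) =
        Q ^ (s * (r + 1)) * (Q ^ (r * (r + 1)) * u ^ (r + 1)) by
          rw [hy, mul_pow, ← pow_mul, add_mul, pow_add]; ring,
      show r * (r + 1) = (r + 1).choose 2 + (r + 1).choose 2 by
        rw [Nat.choose_two_right]
        have := Nat.two_dvd_mul_add_one r
        rw [add_tsub_cancel_right, mul_comm (r + 1)]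
        omega]
    ring
  have s1 : (-1 : R) ^ (r + s + r + 1) = (-1) ^ (r + s + 1) * (-1) ^ r := by ring
  have s2 : (-1 : R) ^ s = - ((-1) ^ (r + s + 1) * (-1) ^ r) := by
    have : (-1 : R) ^ (r + s + 1) * (-1) ^ r = - ((-1) ^ s * ((-1) * (-1)) ^ r) := by
      rw [mul_pow]; ring
    rw [this]; simp
  simp only [one_pow, mul_one]
  rw [mul_assoc _ _ (y ^ s), e1, mul_assoc _ _ (y ^ (r + s + r + 1)), e2, s1, s2,
    show 2 * r + s + 1 = r + s + r + 1 by ring]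
  ring

end IsInvPochhammer

namespace IsInvPochhammer

variable {R : Type*} [CommRing R] {q : R} {J : ℕ → R}

theorem prod_mul_eq_one (h : IsInvPochhammer q J) (n : ℕ) :
    (∏ t ∈ range n, (1 - q ^ (t + 1))) * J n = 1 := by
  induction n with
  | zero => simp [h.zero]
  | succ n ih => rw [prod_range_succ, mul_assoc, h.succ, ih]

theorem map_eq_of_le (h : IsInvPochhammer q J) {S : Type*} [CommRing S] (φ : R →+* S) {L : ℕ}
    (hL : φ q ^ (L + 1) = 0) {m : ℕ} (hm : L ≤ m) : φ (J m) = φ (J L) := by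
  induction m, hm using Nat.le_induction with
  | base => rfl
  | succ m hm ih =>
    rw [← ih, ← h.succ m, map_mul, map_sub, map_pow, pow_eq_zero_of_le (by omega) hL]
    simp

variable [IsDomain R]

/-- A finite form of the second Rogers–Ramanujan identity. -/
theorem finite_rogers_ramanujan (h : IsInvPochhammer q J) (hq : q ≠ 0) (n : ℕ) :
    ∑ p ∈ antidiagonal n, q ^ (p.1 * (p.1 + 1)) * J p.2 * J p.1 =
      ∑ p ∈ antidiagonal n, (-1) ^ p.1 * ((q * q ^ 4) ^ (p.1.choose 2) * (q ^ 4) ^ p.1 -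
        (q * q ^ 4) ^ ((p.1 + 1).choose 2) * q ^ (p.1 + 1)) *
          (J p.2 * J (2 * p.1 + p.2 + 1)) := by
  set α : ℕ → R := fun r => (-1) ^ r * ((q * 1) ^ (r.choose 2) * 1 ^ r -
    (q * 1) ^ ((r + 1).choose 2) * q ^ (r + 1)) with hα
  have h1 : IsInvPochhammer (q * 1) J := by simpa using h
  have hβ : ∀ m, ∑ r ∈ antidiagonal m, α r.1 * (J r.2 * J (2 * r.1 + r.2 + 1)) =
      if m = 0 then 1 else 0 := by
    intro m
    rw [h1.finite_jacobi hq one_ne_zero]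
    rcases m with _ | m
    · have := h.succ 0
      simp_all [h.zero, mul_comm]
    · simp [prod_range_succ' _ m]
  have hβ' : ∀ m, ∑ p ∈ antidiagonal m, q ^ (p.1 * (p.1 + 1)) * α p.1 *
      (J p.2 * J (2 * p.1 + p.2 + 1)) = J m := by
    intro m
    rw [← h.bailey_step α]
    simp only [hβ]
    rw [Finset.Nat.sum_antidiagonal_eq_sum_range_succ_mk, sum_eq_single 0]
    · simp
    · intro b _ hb; simp [hb]
    · simp
  have := h.bailey_step (fun r => q ^ (r * (r + 1)) * α r) n
  simp only [hβ'] at this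
  rw [this]
  refine sum_congr rfl fun p _ => ?_
  rw [← mul_assoc (q ^ _)]
  congr 1
  simp only [hα, mul_one, one_pow]
  have e : p.1 * (p.1 + 1) = 2 * p.1.choose 2 + 2 * p.1 := by
    rw [Nat.choose_two_right]
    rcases p.1 with _ | r
    · rfl
    · have := Nat.two_dvd_mul_add_one r
      rw [add_tsub_cancel_right, mul_comm (r + 1) r]
      obtain ⟨c, hc⟩ := this
      rw [hc, Nat.mul_div_cancel_left _ two_pos]
      nlinarith
  rw [e, Nat.choose_succ_succ' p.1 1, Nat.choose_one_right]
  ring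

theorem rogers_ramanujan_of_pow_eq_zero (h : IsInvPochhammer q J) (hq : q ≠ 0) {J₅ : ℕ → R}
    (h5 : IsInvPochhammer (q * q ^ 4) J₅) {S : Type*} [CommRing S] (φ : R →+* S) {L : ℕ}
    (hL : φ q ^ (L + 1) = 0) :
    (∑ s ∈ range (2 * L + 1), φ (q ^ (s * (s + 1)) * J s)) *
      ∏ t ∈ range (2 * L + 1), ((1 - φ q ^ (5 * t + 2)) * (1 - φ q ^ (5 * t + 3))) = 1 := by
  set x := φ q with hx
  set M := 2 * L + 1 with hM
  set a : ℕ → R := fun r => (-1) ^ r * ((q * q ^ 4) ^ (r.choose 2) * (q ^ 4) ^ r -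
        (q * q ^ 4) ^ ((r + 1).choose 2) * q ^ (r + 1)) with ha
  have hx0 : ∀ m, L + 1 ≤ m → x ^ m = 0 := fun m hm => pow_eq_zero_of_le hm hL
  have hL5 : φ (q * q ^ 4) ^ (L + 1) = 0 := by
    rw [map_mul, mul_pow, hL, zero_mul]
  have ha0 : ∀ r, L + 1 ≤ r → φ (a r) = 0 := by
    intro r hr
    have h1 := hx0 r hr
    have h2 := hx0 (r + 1) (by omega)
    simp only [ha, map_mul, map_sub, map_pow, ← hx]
    rw [← pow_mul, mul_comm 4 r, pow_mul, h1, h2]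
    simp
  set j := φ (J L) with hj
  set j5 := φ (J₅ L) with hj5
  have hA : ∀ (K : ℕ → R) (k : S), (∀ m, L ≤ m → φ (K m) = k) →
      φ (∑ p ∈ antidiagonal (2 * L), a p.1 * (K p.2 * K (2 * p.1 + p.2 + 1))) =
        (∑ r ∈ range M, φ (a r)) * (k * k) := by
    intro K k hK
    rw [Finset.Nat.sum_antidiagonal_eq_sum_range_succ_mk, map_sum, sum_mul]
    refine sum_congr rfl fun r hr => ?_
    rw [map_mul φ (a r), map_mul φ (K _)]
    by_cases hr' : L + 1 ≤ r
    · rw [ha0 r hr']; simp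
    · rw [hK _ (by lia), hK _ (by lia)]
  have hW : φ (∑ p ∈ antidiagonal (2 * L), q ^ (p.1 * (p.1 + 1)) * J p.2 * J p.1) =
      (∑ s ∈ range M, φ (q ^ (s * (s + 1)) * J s)) * j := by
    rw [Finset.Nat.sum_antidiagonal_eq_sum_range_succ_mk, map_sum, sum_mul]
    refine sum_congr rfl fun r hr => ?_
    simp only [map_mul, map_pow, ← hx]
    by_cases hr' : L + 1 ≤ r
    · rw [hx0 (r * (r + 1)) (by nlinarith)]; simp
    · rw [h.map_eq_of_le φ hL (by omega)]; ring
  have hpj : (∏ t ∈ range (5 * M), (1 - x ^ (t + 1))) * j = 1 := by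
    have := congrArg φ (h.prod_mul_eq_one (5 * M))
    rw [map_mul, h.map_eq_of_le φ hL (by omega)] at this
    simpa using this
  have hpj5 : (∏ t ∈ range M, (1 - x ^ (5 * t + 5))) * j5 = 1 := by
    have := congrArg φ (h5.prod_mul_eq_one M)
    rw [map_mul, h5.map_eq_of_le φ hL5 (by omega)] at this
    refine Eq.trans ?_ (this.trans (map_one φ))
    simp only [map_prod, map_sub, map_one, map_pow, map_mul, ← hx]
    congr 1
    refine prod_congr rfl fun t _ => ?_
    ring
  have h1 := congrArg φ (h.finite_rogers_ramanujan hq (2 * L))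
  rw [hW, hA J j fun m hm => h.map_eq_of_le φ hL hm] at h1
  have h2 := congrArg φ (h5.finite_jacobi hq (pow_ne_zero 4 hq) (2 * L))
  rw [hA J₅ j5 fun m hm => h5.map_eq_of_le φ hL5 hm, map_mul,
    h5.map_eq_of_le φ hL5 (by omega), ← hj5] at h2
  have h3 : φ ((∏ t ∈ range (2 * L + 1), (1 - (q * q ^ 4) ^ t * q)) *
      ∏ t ∈ range (2 * L), (1 - (q * q ^ 4) ^ t * q ^ 4)) =
      (∏ t ∈ range M, (1 - x ^ (5 * t + 1))) * ∏ t ∈ range M, (1 - x ^ (5 * t + 4)) := by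
    rw [hM, prod_range_succ _ (2 * L), prod_range_succ _ (2 * L), prod_range_succ _ (2 * L),
      hx0 (5 * (2 * L) + 4) (by omega)]
    simp only [map_prod, map_sub, map_one, map_pow, map_mul, ← hx, sub_zero, mul_one]
    congr 2
    · exact prod_congr rfl fun t _ => by ring
    · ring
    · exact funext fun t => by ring
  rw [h3] at h2
  have h4 : ∏ t ∈ range (5 * M), (1 - x ^ (t + 1)) = (∏ t ∈ range M, (1 - x ^ (5 * t + 1))) *
      (∏ t ∈ range M, ((1 - x ^ (5 * t + 2)) * (1 - x ^ (5 * t + 3)))) *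
      (∏ t ∈ range M, (1 - x ^ (5 * t + 4))) * ∏ t ∈ range M, (1 - x ^ (5 * t + 5)) := by
    generalize M = m
    induction m with
    | zero => simp
    | succ m ih =>
      rw [show 5 * (m + 1) = 5 * m + 1 + 1 + 1 + 1 + 1 by ring]
      simp only [prod_range_succ, ih]
      ring
  rw [h4] at hpj
  generalize ∏ t ∈ range M, ((1 - x ^ (5 * t + 2)) * (1 - x ^ (5 * t + 3))) = P23 at *
  generalize ∏ t ∈ range M, (1 - x ^ (5 * t + 1)) = P1 at *
  generalize ∏ t ∈ range M, (1 - x ^ (5 * t + 4)) = P4 at *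
  generalize ∏ t ∈ range M, (1 - x ^ (5 * t + 5)) = P5 at *
  generalize ∑ r ∈ range M, φ (a r) = A at *
  generalize ∑ s ∈ range M, φ (q ^ (s * (s + 1)) * J s) = W at *
  have h5' : A * j5 = P1 * P4 := by
    linear_combination P5 * h2 - (A * j5 - P1 * P4) * hpj5
  have h6 : W = A * j := by
    linear_combination (P1 * P23 * P4 * P5) * h1 - (W - A * j) * hpj
  rw [h6]
  linear_combination hpj + P5 * j * P23 * h5' - A * j * P23 * hpj5

end IsInvPochhammer

section WeightSeries

open PowerSeries

variable {α β : Type*}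

/-- The generating function counting the elements of `T` by weight. -/
noncomputable def weightSeries (wt : α → ℕ) (T : Set α) : ℚ⟦X⟧ :=
  PowerSeries.mk fun n => ({a ∈ T | wt a = n}.ncard : ℚ)

theorem weightSeries_union {wt : α → ℕ} {S T : Set α} (hST : Disjoint S T)
    (hS : ∀ n, {a ∈ S | wt a = n}.Finite) (hT : ∀ n, {a ∈ T | wt a = n}.Finite) :
    weightSeries wt (S ∪ T) = weightSeries wt S + weightSeries wt T := by
  ext n
  simp only [weightSeries, coeff_mk, map_add]
  rw [← Nat.cast_add, ← Set.ncard_union_eq _ (hS n) (hT n)]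
  · congr 2
    ext a
    simp [or_and_right]
  · exact hST.mono (fun a h => h.1) (fun a h => h.1)

theorem weightSeries_image {wt : α → ℕ} {wt' : β → ℕ} {S : Set β} {f : β → α} (d : ℕ)
    (hf : Set.InjOn f S) (hd : ∀ b ∈ S, wt (f b) = wt' b + d) :
    weightSeries wt (f '' S) = X ^ d * weightSeries wt' S := by
  ext n
  rw [coeff_X_pow_mul']
  simp only [weightSeries, coeff_mk]
  have h : {a ∈ f '' S | wt a = n} = f '' {b ∈ S | wt' b + d = n} := by
    ext a
    constructor
    · rintro ⟨⟨b, hb, rfl⟩, h⟩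
      exact ⟨b, ⟨hb, by rw [← hd b hb, h]⟩, rfl⟩
    · rintro ⟨b, ⟨hb, h⟩, rfl⟩
      exact ⟨⟨b, hb, rfl⟩, by rw [hd b hb, h]⟩
  rw [h, (hf.mono fun b h => h.1).ncard_image]
  split_ifs with hn
  · congr 2
    ext b
    simp only [Set.mem_ofPred_eq]
    exact and_congr_right fun _ => by omega
  · rw [Nat.cast_eq_zero]
    convert! Set.ncard_empty β
    ext b
    simp
    omega

theorem weightSeries_empty (wt : α → ℕ) : weightSeries wt (∅ : Set α) = 0 := by
  ext n
  simp [weightSeries]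

theorem weightSeries_singleton {wt : α → ℕ} {a : α} (ha : wt a = 0) :
    weightSeries wt {a} = 1 := by
  ext n
  simp only [weightSeries, coeff_mk, coeff_one]
  by_cases hn : n = 0
  · have : {b ∈ ({a} : Set α) | wt b = n} = {a} := by
      ext b
      simp only [Set.mem_ofPred_eq, Set.mem_singleton_iff, and_iff_left_iff_imp]
      rintro rfl
      rw [ha, hn]
    rw [this]; simp [hn]
  · have : {b ∈ ({a} : Set α) | wt b = n} = ∅ := by
      ext b
      simp only [Set.mem_ofPred_eq, Set.mem_singleton_iff, Set.mem_empty_iff_false, iff_false]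
      rintro ⟨rfl, h⟩
      omega
    rw [this]; simp [hn]

theorem ncard_eq_sum_fiber {T : Set α} (hT : T.Finite) {ι : Type*} [DecidableEq ι] (s : Finset ι)
    (f : α → ι) (hf : ∀ a ∈ T, f a ∈ s) : T.ncard = ∑ i ∈ s, {a ∈ T | f a = i}.ncard := by
  classical
  rw [Set.ncard_eq_toFinset_card T hT,
    Finset.card_eq_sum_card_fiberwise (f := f) (t := s) (by simpa [Set.MapsTo] using hf)]
  refine Finset.sum_congr rfl fun i _ => ?_
  rw [← Set.ncard_coe_finset]
  congr 1
  ext a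
  simp

end WeightSeries

section Shift

/-- Translate a finite set of naturals. -/
def Finset.shift (d : ℕ) (S : Finset ℕ) : Finset ℕ := S.map (addRightEmbedding d)

theorem Finset.mem_shift {d : ℕ} {S : Finset ℕ} {x : ℕ} :
    x ∈ S.shift d ↔ ∃ y ∈ S, y + d = x := by
  simp [Finset.shift]

theorem Finset.forall_mem_shift {d : ℕ} {S : Finset ℕ} {p : ℕ → Prop} :
    (∀ x ∈ S.shift d, p x) ↔ ∀ x ∈ S, p (x + d) := by
  simp [Finset.shift]

theorem Finset.card_shift (d : ℕ) (S : Finset ℕ) : #(S.shift d) = #S := by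
  simp [Finset.shift]

theorem Finset.sum_shift (d : ℕ) (S : Finset ℕ) : ∑ x ∈ S.shift d, x = ∑ x ∈ S, x + d * #S := by
  simp [Finset.shift, sum_add_distrib, mul_comm]

theorem Finset.shift_injective (d : ℕ) : Function.Injective (Finset.shift d) :=
  Finset.map_injective _

theorem Finset.exists_eq_shift {S : Finset ℕ} (d e : ℕ) (hS : ∀ x ∈ S, d + e ≤ x) :
    ∃ T : Finset ℕ, (∀ x ∈ T, e ≤ x) ∧ S = T.shift d := by
  refine ⟨S.image (· - d), fun x hx => ?_, ?_⟩
  · obtain ⟨y, hy, rfl⟩ := mem_image.mp hx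
    have := hS y hy
    omega
  · ext x
    simp only [mem_shift, mem_image, exists_exists_and_eq_and]
    constructor
    · intro hx
      exact ⟨x, hx, by have := hS x hx; omega⟩
    · rintro ⟨y, hy, rfl⟩
      have := hS y hy
      rwa [show y - d + d = y by omega]

theorem Finset.exists_eq_insert_shift {S : Finset ℕ} (a d e : ℕ) (ha : a ∈ S)
    (hS : ∀ x ∈ S, x ≠ a → d + e ≤ x) :
    ∃ T : Finset ℕ, (∀ x ∈ T, e ≤ x) ∧ S = insert a (T.shift d) := by
  obtain ⟨T, hT, h⟩ := exists_eq_shift (S := S.erase a) d e fun x hx =>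
    hS x (mem_of_mem_erase hx) (ne_of_mem_erase hx)
  exact ⟨T, hT, by rw [← h, insert_erase ha]⟩

theorem Finset.notMem_shift {S : Finset ℕ} {a d e : ℕ} (hS : ∀ x ∈ S, e ≤ x) (h : a < d + e) :
    a ∉ S.shift d := by
  rw [mem_shift]
  rintro ⟨y, hy, rfl⟩
  have := hS y hy
  omega

theorem Finset.finite_setOf_sum_le (n : ℕ) :
    {S : Finset ℕ | (∀ x ∈ S, 1 ≤ x) ∧ ∑ x ∈ S, x ≤ n}.Finite := by
  refine (range (n + 1)).powerset.finite_toSet.subset fun S hS => ?_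
  rw [mem_coe, mem_powerset]
  intro x hx
  have := single_le_sum (f := fun x : ℕ => x) (fun _ _ => Nat.zero_le _) hx
  have := hS.2
  simp only [mem_range]
  omega

theorem Finset.card_le_sum_of_one_le {S : Finset ℕ} (hS : ∀ x ∈ S, 1 ≤ x) : #S ≤ ∑ x ∈ S, x := by
  simpa using Finset.sum_le_sum hS

end Shift

section GapFamily

open PowerSeries

/-- Finite sets of `N` naturals, all at least `2`, with gaps at least `2`. -/
def gapFamily (N : ℕ) : Set (Finset ℕ) :=
  {S | #S = N ∧ (∀ x ∈ S, 2 ≤ x) ∧ ∀ x ∈ S, ∀ y ∈ S, x < y → x + 2 ≤ y}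

theorem finite_gapFamily (N n : ℕ) : {S ∈ gapFamily N | ∑ x ∈ S, x = n}.Finite := by
  refine (finite_setOf_sum_le n).subset fun S hS => ⟨fun x hx => ?_, hS.2.le⟩
  have := hS.1.2.1 x hx
  omega

theorem gapFamily_zero : gapFamily 0 = {∅} := by
  ext S
  simp only [gapFamily, card_eq_zero, Set.mem_ofPred_eq, Set.mem_singleton_iff]
  refine ⟨fun h => h.1, ?_⟩
  rintro rfl
  simp

theorem gapFamily_succ (N : ℕ) : gapFamily (N + 1) = Finset.shift 1 '' gapFamily (N + 1) ∪
    (fun S => insert 2 (S.shift 2)) '' gapFamily N := by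
  ext S
  constructor
  · rintro ⟨hc, h2, hgap⟩
    by_cases h : 2 ∈ S
    · right
      obtain ⟨T, hT, rfl⟩ := exists_eq_insert_shift 2 2 2 h fun x hx hne => by
        have := h2 x hx
        exact hgap 2 h x hx (by omega)
      have hn : 2 ∉ T.shift 2 := notMem_shift hT (by omega)
      rw [card_insert_of_notMem hn, card_shift] at hc
      refine ⟨T, ⟨by omega, hT, fun x hx y hy hxy => ?_⟩, rfl⟩
      have := hgap (x + 2) (mem_insert_of_mem (mem_shift.mpr ⟨x, hx, rfl⟩)) (y + 2)
        (mem_insert_of_mem (mem_shift.mpr ⟨y, hy, rfl⟩)) (by omega)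
      omega
    · left
      obtain ⟨T, hT, rfl⟩ := exists_eq_shift (S := S) 1 2 fun x hx => by
        have := h2 x hx
        have : x ≠ 2 := fun e => h (e ▸ hx)
        omega
      rw [card_shift] at hc
      refine ⟨T, ⟨hc, hT, fun x hx y hy hxy => ?_⟩, rfl⟩
      have := hgap (x + 1) (mem_shift.mpr ⟨x, hx, rfl⟩) (y + 1)
        (mem_shift.mpr ⟨y, hy, rfl⟩) (by omega)
      omega
  · rintro (⟨T, ⟨hc, h2, hgap⟩, rfl⟩ | ⟨T, ⟨hc, h2, hgap⟩, rfl⟩)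
    · refine ⟨by rw [card_shift, hc], ?_, ?_⟩
      · rw [forall_mem_shift]
        intro x hx
        have := h2 x hx
        omega
      · simp only [forall_mem_shift]
        intro x hx y hy hxy
        have := hgap x hx y hy (by omega)
        omega
    · have hn : 2 ∉ T.shift 2 := notMem_shift h2 (by omega)
      refine ⟨by rw [card_insert_of_notMem hn, card_shift, hc], ?_, ?_⟩
      · simp only [forall_mem_insert, forall_mem_shift]
        exact ⟨le_rfl, fun x hx => by omega⟩
      · simp only [forall_mem_insert, forall_mem_shift]
        refine ⟨⟨by omega, fun y hy _ => ?_⟩, fun x hx => ⟨by omega, fun y hy hxy => ?_⟩⟩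
        · have := h2 y hy
          omega
        · have := hgap x hx y hy (by omega)
          omega

theorem weightSeries_gapFamily {J : ℕ → ℚ⟦X⟧} (hJ : IsInvPochhammer X J) (N : ℕ) :
    weightSeries (fun S => ∑ x ∈ S, x) (gapFamily N) = X ^ (N * (N + 1)) * J N := by
  induction N with
  | zero => rw [gapFamily_zero, weightSeries_singleton (by simp)]; simp [hJ.zero]
  | succ N ih =>
    have h1 := weightSeries_image (wt := fun S : Finset ℕ => ∑ x ∈ S, x)
      (wt' := fun S : Finset ℕ => ∑ x ∈ S, x) (S := gapFamily (N + 1)) (N + 1)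
      (shift_injective 1).injOn fun S hS => by rw [sum_shift, hS.1, one_mul]
    have h2 := weightSeries_image (wt := fun S : Finset ℕ => ∑ x ∈ S, x)
      (wt' := fun S : Finset ℕ => ∑ x ∈ S, x) (S := gapFamily N)
      (f := fun S => insert 2 (S.shift 2)) (2 * N + 2)
      (by
        intro S hS T hT h
        have hS' : 2 ∉ S.shift 2 := notMem_shift hS.2.1 (by omega)
        have hT' : 2 ∉ T.shift 2 := notMem_shift hT.2.1 (by omega)
        apply shift_injective 2
        rw [← erase_insert hS', ← erase_insert hT']
        exact congrArg (fun U => erase U 2) h)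
      fun S hS => by
        rw [sum_insert (notMem_shift hS.2.1 (by omega)), sum_shift, hS.1]; ring
    have h3 := weightSeries_union (wt := fun S : Finset ℕ => ∑ x ∈ S, x)
      (S := Finset.shift 1 '' gapFamily (N + 1))
      (T := (fun S => insert 2 (S.shift 2)) '' gapFamily N)
      (by
        rw [Set.disjoint_left]
        rintro _ ⟨S, hS, rfl⟩ ⟨T, hT, h⟩
        have : 2 ∉ S.shift 1 := notMem_shift hS.2.1 (by omega)
        rw [← h] at this
        simp at this)
      (fun n => (finite_gapFamily (N + 1) n).subset fun S hS =>
        ⟨by rw [gapFamily_succ]; exact Or.inl hS.1, hS.2⟩)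
      (fun n => (finite_gapFamily (N + 1) n).subset fun S hS =>
        ⟨by rw [gapFamily_succ]; exact Or.inr hS.1, hS.2⟩)
    rw [← gapFamily_succ, h1, h2, ih, ← hJ.succ] at h3
    apply mul_left_cancel₀ (hJ.ne_zero N)
    linear_combination h3

end GapFamily

section SeparatedPair

open PowerSeries

/-- The number of elements of `U` that are at most `u`. -/
def Finset.rank (U : Finset ℕ) (u : ℕ) : ℕ := #{x ∈ U | x ≤ u}

theorem Finset.rank_shift (d : ℕ) (U : Finset ℕ) (u : ℕ) :
    (U.shift d).rank (u + d) = U.rank u := by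
  have : {x ∈ U.shift d | x ≤ u + d} = Finset.shift d {x ∈ U | x ≤ u} := by
    ext x
    simp only [mem_filter, mem_shift]
    constructor
    · rintro ⟨⟨y, hy, rfl⟩, h⟩
      exact ⟨y, ⟨hy, by omega⟩, rfl⟩
    · rintro ⟨y, ⟨hy, h⟩, rfl⟩
      exact ⟨⟨y, hy, rfl⟩, by omega⟩
  rw [rank, this, card_shift, rank]

theorem Finset.rank_insert_of_le {U : Finset ℕ} {a u : ℕ} (ha : a ∉ U) (h : a ≤ u) :
    (insert a U).rank u = U.rank u + 1 := by
  rw [rank, rank, filter_insert, if_pos h, card_insert_of_notMem (by simp [ha])]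

theorem Finset.rank_eq_zero {U : Finset ℕ} {u : ℕ} (h : ∀ x ∈ U, u < x) : U.rank u = 0 := by
  rw [rank, card_eq_zero, filter_eq_empty_iff]
  intro x hx
  have := h x hx
  omega

theorem Finset.rank_pos {U : Finset ℕ} {u : ℕ} (h : u ∈ U) : 0 < U.rank u :=
  card_pos.mpr ⟨u, by simp [h]⟩

/-- Pairs of finite sets of `k` and `m` positive naturals such that, if `u` is the `j`-th smallest
element of the first set, then neither `u + j - 1` nor `u + j` belongs to the second one. -/
def separatedPairs (k m : ℕ) : Set (Finset ℕ × Finset ℕ) :=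
  {p | #p.1 = k ∧ #p.2 = m ∧ (∀ u ∈ p.1, 1 ≤ u) ∧ (∀ v ∈ p.2, 1 ≤ v) ∧
    ∀ u ∈ p.1, ∀ v ∈ p.2, v + 1 ≠ u + p.1.rank u ∧ v ≠ u + p.1.rank u}

/-- Twice the sum of all elements, plus `a` for every element of the first set and `b` for every
element of the second set. -/
def pairWeight (a b : ℕ) (p : Finset ℕ × Finset ℕ) : ℕ :=
  2 * (∑ u ∈ p.1, u + ∑ v ∈ p.2, v) + a * #p.1 + b * #p.2

theorem finite_separatedPairs (a b k m n : ℕ) :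
    {p ∈ separatedPairs k m | pairWeight a b p = n}.Finite := by
  refine ((finite_setOf_sum_le n).prod (finite_setOf_sum_le n)).subset fun p hp => ?_
  obtain ⟨⟨-, -, h1, h2, -⟩, rfl⟩ := hp
  refine ⟨⟨h1, ?_⟩, h2, ?_⟩ <;> rw [pairWeight] <;> ring_nf <;> omega

theorem separatedPairs_zero : separatedPairs 0 0 = {(∅, ∅)} := by
  ext ⟨U, V⟩
  simp only [separatedPairs, card_eq_zero, Set.mem_ofPred_eq, Set.mem_singleton_iff, Prod.mk.injEq]
  refine ⟨fun h => ⟨h.1, h.2.1⟩, ?_⟩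
  rintro ⟨rfl, rfl⟩
  simp

theorem separatedPairs_filter_notMem (k m : ℕ) :
    {p ∈ separatedPairs k m | 1 ∉ p.1 ∧ 1 ∉ p.2} =
      (fun p => (p.1.shift 1, p.2.shift 1)) '' separatedPairs k m := by
  ext ⟨U, V⟩
  constructor
  · rintro ⟨⟨hk, hm, hU, hV, h⟩, h1, h2⟩
    obtain ⟨U, hU', rfl⟩ := exists_eq_shift (S := U) 1 1 fun x hx => by
      have := hU x hx
      have : x ≠ 1 := fun e => h1 (e ▸ hx)
      omega
    obtain ⟨V, hV', rfl⟩ := exists_eq_shift (S := V) 1 1 fun x hx => by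
      have := hV x hx
      have : x ≠ 1 := fun e => h2 (e ▸ hx)
      omega
    simp only [forall_mem_shift, rank_shift, card_shift] at h hk hm
    refine ⟨(U, V), ⟨hk, hm, hU', hV', fun u hu v hv => ?_⟩, rfl⟩
    have := h u hu v hv
    dsimp only
    omega
  · rintro ⟨⟨U, V⟩, ⟨hk, hm, hU, hV, h⟩, h'⟩
    dsimp only at hk hm hU hV h
    obtain ⟨rfl, rfl⟩ := Prod.mk.inj h'
    refine ⟨⟨by rw [card_shift, hk], by rw [card_shift, hm], ?_, ?_, ?_⟩,
      notMem_shift hU (by omega), notMem_shift hV (by omega)⟩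
    · simp [forall_mem_shift]
    · simp [forall_mem_shift]
    · simp only [forall_mem_shift, rank_shift]
      intro u hu v hv
      have := h u hu v hv
      omega

theorem separatedPairs_filter_mem_right (k m : ℕ) :
    {p ∈ separatedPairs k (m + 1) | 1 ∈ p.2} =
      (fun p => (p.1.shift 1, insert 1 (p.2.shift 1))) '' separatedPairs k m := by
  ext ⟨U, V⟩
  constructor
  · rintro ⟨⟨hk, hm, hU, hV, h⟩, h1⟩
    obtain ⟨U, hU', rfl⟩ := exists_eq_shift (S := U) 1 1 fun x hx => by
      have := hU x hx
      have : x ≠ 1 := by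
        rintro rfl
        have hr := h 1 hx 1 h1
        rw [show U = insert 1 (U.erase 1) from (insert_erase hx).symm,
          rank_insert_of_le (by simp) le_rfl, rank_eq_zero] at hr
        · simp at hr
        · intro x hx
          have := hU x (mem_of_mem_erase hx)
          have := ne_of_mem_erase hx
          omega
      omega
    obtain ⟨V, hV', rfl⟩ := exists_eq_insert_shift 1 1 1 h1 fun x hx hne => by
      have := hV x hx
      omega
    have hn : 1 ∉ V.shift 1 := notMem_shift hV' (by omega)
    dsimp only at hk hm h
    rw [card_shift] at hk
    rw [card_insert_of_notMem hn, card_shift] at hm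
    simp only [forall_mem_shift, rank_shift, forall_mem_insert] at h
    refine ⟨(U, V), ⟨hk, by dsimp only; omega, hU', hV', fun u hu v hv => ?_⟩, rfl⟩
    have := (h u hu).2 v hv
    dsimp only
    omega
  · rintro ⟨⟨U, V⟩, ⟨hk, hm, hU, hV, h⟩, h'⟩
    dsimp only at hk hm hU hV h
    obtain ⟨rfl, rfl⟩ := Prod.mk.inj h'
    have hn : 1 ∉ V.shift 1 := notMem_shift hV (by omega)
    refine ⟨⟨by rw [card_shift, hk], by rw [card_insert_of_notMem hn, card_shift, hm], ?_, ?_, ?_⟩,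
      mem_insert_self _ _⟩
    · simp [forall_mem_shift]
    · simp [forall_mem_shift]
    · simp only [forall_mem_shift, rank_shift, forall_mem_insert]
      intro u hu
      have := rank_pos hu
      have := hU u hu
      refine ⟨by omega, fun v hv => ?_⟩
      have := h u hu v hv
      omega

theorem separatedPairs_filter_mem_left (k m : ℕ) :
    {p ∈ separatedPairs (k + 1) m | 1 ∈ p.1} =
      (fun p => (insert 1 (p.1.shift 1), p.2.shift 2)) '' separatedPairs k m := by
  have rank_one {U : Finset ℕ} (hU : ∀ u ∈ U, 1 ≤ u) : (insert 1 (U.shift 1)).rank 1 = 1 := by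
    rw [rank_insert_of_le (notMem_shift hU (by omega)) le_rfl, rank_eq_zero]
    rw [forall_mem_shift]
    intro x hx
    have := hU x hx
    omega
  have rank_add {U : Finset ℕ} (hU : ∀ u ∈ U, 1 ≤ u) (u : ℕ) :
      (insert 1 (U.shift 1)).rank (u + 1) = U.rank u + 1 := by
    rw [rank_insert_of_le (notMem_shift hU (by omega)) (by omega), rank_shift]
  ext ⟨U, V⟩
  constructor
  · rintro ⟨⟨hk, hm, hU, hV, h⟩, h1⟩
    obtain ⟨U, hU', rfl⟩ := exists_eq_insert_shift 1 1 1 h1 fun x hx hne => by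
      have := hU x hx
      omega
    have hn : 1 ∉ U.shift 1 := notMem_shift hU' (by omega)
    dsimp only at hk hm h hV
    simp only [forall_mem_insert, rank_one hU', forall_mem_shift, rank_add hU'] at h
    obtain ⟨V, hV', rfl⟩ := exists_eq_shift (S := V) 2 1 fun x hx => by
      have := hV x hx
      have := h.1 x hx
      omega
    rw [card_shift] at hm
    rw [card_insert_of_notMem hn, card_shift] at hk
    simp only [forall_mem_shift] at h
    refine ⟨(U, V), ⟨by dsimp only; omega, hm, hU', hV', fun u hu v hv => ?_⟩, rfl⟩
    have := h.2 u hu v hv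
    dsimp only
    omega
  · rintro ⟨⟨U, V⟩, ⟨hk, hm, hU, hV, h⟩, h'⟩
    dsimp only at hk hm hU hV h
    obtain ⟨rfl, rfl⟩ := Prod.mk.inj h'
    have hn : 1 ∉ U.shift 1 := notMem_shift hU (by omega)
    refine ⟨⟨by rw [card_insert_of_notMem hn, card_shift, hk], by rw [card_shift, hm], ?_, ?_, ?_⟩,
      mem_insert_self _ _⟩
    · simp [forall_mem_shift]
    · simp [forall_mem_shift]
    · simp only [forall_mem_insert, rank_one hU, forall_mem_shift, rank_add hU]
      refine ⟨fun v hv => ?_, fun u hu v hv => ?_⟩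
      · have := hV v hv
        omega
      · have := h u hu v hv
        omega

theorem Finset.insert_shift_inj {S T : Finset ℕ} {a d e : ℕ} (hS : ∀ x ∈ S, e ≤ x)
    (hT : ∀ x ∈ T, e ≤ x) (ha : a < d + e) (h : insert a (S.shift d) = insert a (T.shift d)) :
    S = T := by
  apply shift_injective d
  rw [← erase_insert (notMem_shift hS ha), h, erase_insert (notMem_shift hT ha)]

theorem weightSeries_filter_mem_right {J : ℕ → ℚ⟦X⟧} (hJ : IsInvPochhammer (X ^ 2) J) (a b k m : ℕ)
    (ih : ∀ m' < m, weightSeries (pairWeight a b) (separatedPairs k m') =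
      X ^ ((k + m') * (k + m' + 1) + a * k + b * m') * (J k * J m')) :
    weightSeries (pairWeight a b) {p ∈ separatedPairs k m | 1 ∈ p.2} =
      X ^ ((k + m) * (k + m + 1) + a * k + b * m) * (J k * ((1 - (X ^ 2) ^ m) * J m)) := by
  cases m with
  | zero =>
    have : {p ∈ separatedPairs k 0 | 1 ∈ p.2} = ∅ := by
      refine Set.eq_empty_of_forall_notMem fun p hp => ?_
      have := card_eq_zero.mp hp.1.2.1
      have := hp.2
      simp_all
    rw [this, weightSeries_empty]
    simp
  | succ m =>
    rw [hJ.succ, separatedPairs_filter_mem_right,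
      weightSeries_image (wt' := pairWeight a b) (2 * (k + m) + 2 + b), ih m (by omega)]
    · rw [← mul_assoc, ← pow_add]
      congr 2
      ring
    · rintro ⟨U, V⟩ hp ⟨U', V'⟩ hp' h
      obtain ⟨h1, h2⟩ := Prod.mk.inj h
      exact Prod.ext (shift_injective 1 h1)
        (insert_shift_inj hp.2.2.2.1 hp'.2.2.2.1 (by omega) h2)
    · rintro ⟨U, V⟩ ⟨hk, hm, hU, hV, -⟩
      dsimp only at hk hm hU hV
      have hn : 1 ∉ V.shift 1 := notMem_shift hV (by omega)
      simp only [pairWeight]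
      rw [sum_insert hn, card_insert_of_notMem hn, sum_shift, sum_shift, card_shift, card_shift,
        hk, hm]
      ring

theorem weightSeries_filter_mem_left {J : ℕ → ℚ⟦X⟧} (hJ : IsInvPochhammer (X ^ 2) J) (a b k m : ℕ)
    (ih : ∀ k' < k, weightSeries (pairWeight a b) (separatedPairs k' m) =
      X ^ ((k' + m) * (k' + m + 1) + a * k' + b * m) * (J k' * J m)) :
    weightSeries (pairWeight a b) {p ∈ separatedPairs k m | 1 ∈ p.1} =
      X ^ ((k + m) * (k + m + 1) + a * k + b * m) *
        ((X ^ 2) ^ m * ((1 - (X ^ 2) ^ k) * J k * J m)) := by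
  cases k with
  | zero =>
    have : {p ∈ separatedPairs 0 m | 1 ∈ p.1} = ∅ := by
      refine Set.eq_empty_of_forall_notMem fun p hp => ?_
      have := card_eq_zero.mp hp.1.1
      have := hp.2
      simp_all
    rw [this, weightSeries_empty]
    simp
  | succ k =>
    rw [hJ.succ, separatedPairs_filter_mem_left,
      weightSeries_image (wt' := pairWeight a b) (2 + a + 2 * k + 4 * m), ih k (by omega)]
    · ring
    · rintro ⟨U, V⟩ hp ⟨U', V'⟩ hp' h
      obtain ⟨h1, h2⟩ := Prod.mk.inj h
      exact Prod.ext (insert_shift_inj hp.2.2.1 hp'.2.2.1 (by omega) h1) (shift_injective 2 h2)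
    · rintro ⟨U, V⟩ ⟨hk, hm, hU, hV, -⟩
      dsimp only at hk hm hU hV
      have hn : 1 ∉ U.shift 1 := notMem_shift hU (by omega)
      simp only [pairWeight]
      rw [sum_insert hn, card_insert_of_notMem hn, sum_shift, sum_shift, card_shift, card_shift,
        hk, hm]
      ring

theorem weightSeries_separatedPairs {J : ℕ → ℚ⟦X⟧} (hJ : IsInvPochhammer (X ^ 2) J) (a b k m : ℕ) :
    weightSeries (pairWeight a b) (separatedPairs k m) =
      X ^ ((k + m) * (k + m + 1) + a * k + b * m) * (J k * J m) := by
  induction hN : k + m using Nat.strong_induction_on generalizing k m with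
  | _ N ih =>
  subst hN
  obtain h0 | h0 := Nat.eq_zero_or_pos (k + m)
  · obtain ⟨rfl, rfl⟩ : k = 0 ∧ m = 0 := by omega
    rw [separatedPairs_zero, weightSeries_singleton (by simp [pairWeight])]
    simp [hJ.zero]
  · have h2 := weightSeries_filter_mem_right hJ a b k m fun m' hm => ih (k + m') (by omega) _ _ rfl
    have h1 := weightSeries_filter_mem_left hJ a b k m fun k' hk => ih (k' + m) (by omega) _ _ rfl
    have h3 : weightSeries (pairWeight a b) {p ∈ separatedPairs k m | 1 ∉ p.1 ∧ 1 ∉ p.2} =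
        X ^ (2 * (k + m)) * weightSeries (pairWeight a b) (separatedPairs k m) := by
      rw [separatedPairs_filter_notMem, weightSeries_image (wt' := pairWeight a b) (2 * (k + m))]
      · rintro ⟨U, V⟩ hp ⟨U', V'⟩ hp' h
        obtain ⟨h1, h2⟩ := Prod.mk.inj h
        exact Prod.ext (shift_injective 1 h1) (shift_injective 1 h2)
      · rintro ⟨U, V⟩ ⟨hk, hm, -⟩
        dsimp only at hk hm
        simp only [pairWeight]
        rw [sum_shift, sum_shift, card_shift, card_shift, hk, hm]
        ring
    have hfin {P : Finset ℕ × Finset ℕ → Prop} (n : ℕ) :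
        {p ∈ {p ∈ separatedPairs k m | P p} | pairWeight a b p = n}.Finite :=
      (finite_separatedPairs a b k m n).subset fun p hp => ⟨hp.1.1, hp.2⟩
    have h12 : {p ∈ separatedPairs k m | 1 ∈ p.1 ∨ 1 ∈ p.2} =
        {p ∈ separatedPairs k m | 1 ∈ p.1} ∪ {p ∈ separatedPairs k m | 1 ∈ p.2} := by
      ext p
      simp [and_or_left]
    have h123 : separatedPairs k m = {p ∈ separatedPairs k m | 1 ∉ p.1 ∧ 1 ∉ p.2} ∪
        {p ∈ separatedPairs k m | 1 ∈ p.1 ∨ 1 ∈ p.2} := by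
      ext p
      simp only [Set.mem_union, Set.mem_ofPred_eq]
      tauto
    have key : weightSeries (pairWeight a b) (separatedPairs k m) =
        weightSeries (pairWeight a b) {p ∈ separatedPairs k m | 1 ∉ p.1 ∧ 1 ∉ p.2} +
        (weightSeries (pairWeight a b) {p ∈ separatedPairs k m | 1 ∈ p.1} +
        weightSeries (pairWeight a b) {p ∈ separatedPairs k m | 1 ∈ p.2}) := by
      rw [← weightSeries_union _ hfin hfin, ← h12, ← weightSeries_union _ hfin hfin, ← h123]
      · rw [Set.disjoint_left]
        rintro p ⟨-, hp⟩ ⟨-, hp'⟩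
        tauto
      · rw [Set.disjoint_left]
        rintro p ⟨hp, hp1⟩ ⟨-, hp2⟩
        obtain ⟨k, rfl⟩ : ∃ k', k = k' + 1 := Nat.exists_eq_succ_of_ne_zero (by
          rintro rfl
          have := card_eq_zero.mp hp.1
          simp_all)
        have : p ∈ {p ∈ separatedPairs (k + 1) m | 1 ∈ p.1} := ⟨hp, hp1⟩
        rw [separatedPairs_filter_mem_left] at this
        obtain ⟨p', hp', rfl⟩ := this
        exact notMem_shift hp'.2.2.2.1 (by omega) hp2
    obtain ⟨N, hN⟩ := Nat.exists_eq_succ_of_ne_zero h0.ne'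
    apply mul_left_cancel₀ (hJ.ne_zero N)
    rw [h1, h2, h3, pow_mul] at key
    rw [← Nat.succ_eq_add_one, ← hN]
    rw [pow_add (X ^ 2) k m] at key ⊢
    linear_combination key

theorem IsInvPochhammer.sum_antidiagonal_pow_fst_mul {R : Type*} [CommRing R] [IsDomain R] {q : R}
    {J J₂ : ℕ → R} (hJ : IsInvPochhammer q J) (hJ₂ : IsInvPochhammer (q ^ 2) J₂) (N : ℕ) :
    ∑ p ∈ antidiagonal N, q ^ p.1 * (J₂ p.1 * J₂ p.2) = J N := by
  induction N with
  | zero => simp [hJ.zero, hJ₂.zero]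
  | succ N ih =>
    apply mul_left_cancel₀ (hJ.ne_zero N)
    have h : q ^ (N + 1) * ∑ p ∈ antidiagonal (N + 1), q ^ p.1 * (J₂ p.1 * J₂ p.2) =
        ∑ p ∈ antidiagonal (N + 1), q ^ p.1 * (J₂ p.1 * ((q ^ 2) ^ p.2 * J₂ p.2)) := by
      rw [mul_sum, ← Finset.Nat.sum_antidiagonal_swap]
      refine sum_congr rfl fun p hp => ?_
      rw [← mem_antidiagonal.mp hp]
      simp only [Prod.fst_swap, Prod.snd_swap]
      ring
    rw [sub_mul, one_mul, h, ← sum_sub_distrib, hJ.succ, ← ih, Finset.Nat.sum_antidiagonal_succ']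
    simp only [pow_zero, one_mul, sub_self, zero_add]
    refine sum_congr rfl fun p _ => ?_
    rw [← hJ₂.succ p.2]
    ring

end SeparatedPair

section Multiset

open PowerSeries

theorem Multiset.finite_setOf_sum_eq (n : ℕ) : {M : Multiset ℕ | 0 ∉ M ∧ M.sum = n}.Finite := by
  refine (Set.finite_range fun p : n.Partition => p.parts).subset ?_
  rintro M ⟨h0, h⟩
  exact ⟨⟨M, fun hi => Nat.pos_of_ne_zero fun e => h0 (e ▸ hi), h⟩, rfl⟩

theorem weightSeries_multiset_mul_prod {s : Finset ℕ} (hs : 0 ∉ s) :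
    weightSeries Multiset.sum {M : Multiset ℕ | ∀ x ∈ M, x ∈ s} * ∏ a ∈ s, (1 - X ^ a) = 1 := by
  induction s using Finset.induction_on with
  | empty =>
    have : {M : Multiset ℕ | ∀ x ∈ M, x ∈ (∅ : Finset ℕ)} = {0} := by
      ext M
      simp [Multiset.eq_zero_iff_forall_notMem]
    rw [this, weightSeries_singleton (by simp)]
    simp
  | insert a s ha ih =>
    have hfin (n : ℕ) :
        {M ∈ {M : Multiset ℕ | ∀ x ∈ M, x ∈ insert a s} | M.sum = n}.Finite :=
      (Multiset.finite_setOf_sum_eq n).subset fun M hM => ⟨fun h => hs (hM.1 0 h), hM.2⟩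
    have h1 : {M : Multiset ℕ | ∀ x ∈ M, x ∈ insert a s} = {M : Multiset ℕ | ∀ x ∈ M, x ∈ s} ∪
        (a ::ₘ ·) '' {M : Multiset ℕ | ∀ x ∈ M, x ∈ insert a s} := by
      ext M
      constructor
      · intro hM
        by_cases h : a ∈ M
        · obtain ⟨M, rfl⟩ := Multiset.exists_cons_of_mem h
          exact Or.inr ⟨M, fun x hx => hM x (Multiset.mem_cons_of_mem hx), rfl⟩
        · exact Or.inl fun x hx =>
            (mem_insert.mp (hM x hx)).resolve_left fun e => h (e ▸ hx)
      · rintro (hM | ⟨M, hM, rfl⟩)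
        · exact fun x hx => mem_insert_of_mem (hM x hx)
        · intro x hx
          obtain rfl | hx := Multiset.mem_cons.mp hx
          · exact mem_insert_self _ _
          · exact hM x hx
    have h2 : weightSeries Multiset.sum {M : Multiset ℕ | ∀ x ∈ M, x ∈ insert a s} =
        weightSeries Multiset.sum {M : Multiset ℕ | ∀ x ∈ M, x ∈ s} +
        X ^ a * weightSeries Multiset.sum {M : Multiset ℕ | ∀ x ∈ M, x ∈ insert a s} := by
      rw [← weightSeries_image (f := (a ::ₘ ·)) (wt := Multiset.sum) a
        (fun M _ N _ h => (Multiset.cons_inj_right a).mp h) (fun M _ => by simp [add_comm]),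
        ← weightSeries_union, ← h1]
      · rw [Set.disjoint_left]
        rintro _ hM ⟨M, -, rfl⟩
        exact ha (hM a (Multiset.mem_cons_self _ _))
      · exact fun n => (hfin n).subset fun M hM => ⟨by rw [h1]; exact Or.inl hM.1, hM.2⟩
      · exact fun n => (hfin n).subset fun M hM => ⟨by rw [h1]; exact Or.inr hM.1, hM.2⟩
    rw [prod_insert ha]
    linear_combination (∏ a ∈ s, (1 - X ^ a)) * h2 + ih fun h => hs (mem_insert_of_mem h)

end Multiset

section InvPochhammer

open PowerSeries

/-- The reciprocal of `(q; q)_n` as a power series, for `q = X ^ d`. -/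
noncomputable def invPochhammer (d n : ℕ) : ℚ⟦X⟧ := ∏ i ∈ range n, (1 - (X ^ d) ^ (i + 1))⁻¹

theorem isInvPochhammer_invPochhammer {d : ℕ} (hd : d ≠ 0) :
    IsInvPochhammer (X ^ d : ℚ⟦X⟧) (invPochhammer d) := by
  have hc (n : ℕ) : constantCoeff (1 - (X ^ d : ℚ⟦X⟧) ^ (n + 1)) = 1 := by
    simp [hd]
  refine ⟨by simp [invPochhammer], fun n => ?_, fun n h => ?_⟩
  · rw [invPochhammer, prod_range_succ, mul_comm, mul_assoc,
      PowerSeries.inv_mul_cancel _ (by rw [hc]; exact one_ne_zero), mul_one, invPochhammer]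
  · have := hc n
    rw [h] at this
    simp at this

theorem coeff_sum_pow_mul_invPochhammer (n : ℕ) :
    coeff n (∑ N ∈ range (2 * n + 1), X ^ (N * (N + 1)) * invPochhammer 1 N) =
      ({M : Multiset ℕ | (∀ x ∈ M, x % 5 = 2 ∨ x % 5 = 3) ∧ M.sum = n}.ncard : ℚ) := by
  set F : ℚ⟦X⟧ := ∑ N ∈ range (2 * n + 1), X ^ (N * (N + 1)) * invPochhammer 1 N with hF
  set s : Finset ℕ := (range (2 * n + 1)).image (fun t => 5 * t + 2) ∪
    (range (2 * n + 1)).image (fun t => 5 * t + 3) with hs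
  set P : ℚ⟦X⟧ := ∏ a ∈ s, (1 - X ^ a) with hP
  have hP' : P = ∏ t ∈ range (2 * n + 1), ((1 - X ^ (5 * t + 2)) * (1 - X ^ (5 * t + 3))) := by
    rw [hP, hs, prod_union, prod_image, prod_image, prod_mul_distrib]
    · intro x _ y _ h
      simpa using h
    · intro x _ y _ h
      simpa using h
    · rw [disjoint_left]
      simp only [mem_image, not_exists, not_and]
      rintro _ ⟨x, -, rfl⟩ y -
      omega
  have hB := weightSeries_multiset_mul_prod (s := s) (by simp [hs])
  have hRR : X ^ (n + 1) ∣ F * P - 1 := by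
    rw [← Ideal.mem_span_singleton, ← Ideal.Quotient.eq_zero_iff_mem, map_sub, sub_eq_zero, map_one]
    have h1 := isInvPochhammer_invPochhammer one_ne_zero
    rw [pow_one] at h1
    have h5 := isInvPochhammer_invPochhammer (d := 5) (by norm_num)
    rw [show (X : ℚ⟦X⟧) ^ 5 = X * X ^ 4 by ring] at h5
    have := h1.rogers_ramanujan_of_pow_eq_zero X_ne_zero h5
      (Ideal.Quotient.mk (Ideal.span {(X : ℚ⟦X⟧) ^ (n + 1)})) (L := n) (by
        rw [← map_pow, Ideal.Quotient.eq_zero_iff_mem]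
        exact Ideal.mem_span_singleton_self _)
    rw [hP', hF]
    simpa [map_mul, map_sum, map_prod] using this
  have hdiff : X ^ (n + 1) ∣
      F - weightSeries Multiset.sum {M : Multiset ℕ | ∀ x ∈ M, x ∈ s} := by
    have := hRR.mul_right (weightSeries Multiset.sum {M : Multiset ℕ | ∀ x ∈ M, x ∈ s})
    convert this using 1
    linear_combination -F * hB
  have hcoeff := X_pow_dvd_iff.mp hdiff n (by omega)
  rw [map_sub, sub_eq_zero] at hcoeff
  rw [hcoeff, weightSeries, coeff_mk]
  congr 2
  ext M
  refine and_congr_left fun hM => forall₂_congr fun x hx => ?_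
  have := Multiset.le_sum_of_mem hx
  simp only [hs, mem_union, mem_image, mem_range]
  constructor
  · rintro (⟨t, -, rfl⟩ | ⟨t, -, rfl⟩) <;> omega
  · rintro (h | h)
    · exact Or.inl ⟨x / 5, by omega, by omega⟩
    · exact Or.inr ⟨x / 5, by omega, by omega⟩

end InvPochhammer

section Partition

open PowerSeries

theorem Nat.Partition.card_subtype_eq_ncard (n : ℕ) (P : Multiset ℕ → Prop) :
    Nat.card {p : n.Partition // P p.parts} =
      {M : Multiset ℕ | 0 ∉ M ∧ P M ∧ M.sum = n}.ncard := by
  have : {M : Multiset ℕ | 0 ∉ M ∧ P M ∧ M.sum = n} =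
      Nat.Partition.parts '' {p : n.Partition | P p.parts} := by
    ext M
    constructor
    · rintro ⟨h0, hP, h⟩
      exact ⟨⟨M, fun hi => Nat.pos_of_ne_zero fun e => h0 (e ▸ hi), h⟩, hP, rfl⟩
    · rintro ⟨p, hp, rfl⟩
      exact ⟨fun h => (p.parts_pos h).ne rfl, hp, p.parts_sum⟩
  rw [this, Set.ncard_image_of_injective _ fun p q h => Nat.Partition.ext h,
    ← Nat.card_coe_set_eq]
  rfl

theorem Nat.Partition.card_nodup_eq_ncard (n : ℕ) (P : Multiset ℕ → Prop) :
    Nat.card {p : n.Partition // p.parts.Nodup ∧ 1 ∉ p.parts ∧ P p.parts} =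
      {S : Finset ℕ | (∀ x ∈ S, 2 ≤ x) ∧ P S.val ∧ ∑ x ∈ S, x = n}.ncard := by
  rw [card_subtype_eq_ncard n fun M => M.Nodup ∧ 1 ∉ M ∧ P M,
    ← Set.ncard_image_of_injective _ Finset.val_injective]
  congr 1
  ext M
  constructor
  · rintro ⟨h0, ⟨hM, h1, hP⟩, h⟩
    refine ⟨⟨M, hM⟩, ⟨fun x hx => ?_, hP, by simpa using h⟩, rfl⟩
    have : x ≠ 0 := fun e => h0 (e ▸ hx)
    have : x ≠ 1 := fun e => h1 (e ▸ hx)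
    omega
  · rintro ⟨S, ⟨h2, hP, h⟩, rfl⟩
    refine ⟨fun h => ?_, ⟨S.nodup, fun h => ?_, hP⟩, by simpa using h⟩
    · have := h2 0 h
      omega
    · have := h2 1 h
      omega

theorem ncard_gap_eq_coeff (n : ℕ) :
    ({S : Finset ℕ | (∀ x ∈ S, 2 ≤ x) ∧ (∀ x ∈ S, ∀ y ∈ S, x < y → x + 2 ≤ y) ∧
      ∑ x ∈ S, x = n}.ncard : ℚ) =
      coeff n (∑ N ∈ range (2 * n + 1), X ^ (N * (N + 1)) * invPochhammer 1 N) := by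
  have h1 := isInvPochhammer_invPochhammer one_ne_zero
  rw [pow_one] at h1
  rw [ncard_eq_sum_fiber ((finite_setOf_sum_le n).subset
      fun S hS => ⟨fun x hx => one_le_two.trans (hS.1 x hx), hS.2.2.le⟩) (range (2 * n + 1)) card,
    Nat.cast_sum, map_sum]
  · refine sum_congr rfl fun N _ => ?_
    rw [← weightSeries_gapFamily h1, weightSeries, coeff_mk]
    congr 2
    ext S
    simp only [gapFamily, Set.mem_ofPred_eq]
    tauto
  · rintro S ⟨h2, -, h⟩
    have := card_le_sum_of_one_le fun x hx => one_le_two.trans (h2 x hx)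
    rw [mem_range]
    omega

/-- The set with elements `2 * u + a` for `u` in the first set and `2 * v + b` for `v` in the
second one. -/
def interleave (a b : ℕ) (p : Finset ℕ × Finset ℕ) : Finset ℕ :=
  p.1.image (fun u => 2 * u + a) ∪ p.2.image (fun v => 2 * v + b)

section Interleave

variable {a b : ℕ}

theorem mem_interleave_left (hab : a + b = 1) {p : Finset ℕ × Finset ℕ} {u : ℕ} :
    2 * u + a ∈ interleave a b p ↔ u ∈ p.1 := by
  simp only [interleave, mem_union, mem_image]
  constructor
  · rintro (⟨x, hx, h⟩ | ⟨x, hx, h⟩)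
    · rwa [show u = x by omega]
    · omega
  · exact fun h => Or.inl ⟨u, h, rfl⟩

theorem mem_interleave_right (hab : a + b = 1) {p : Finset ℕ × Finset ℕ} {v : ℕ} :
    2 * v + b ∈ interleave a b p ↔ v ∈ p.2 := by
  simp only [interleave, mem_union, mem_image]
  constructor
  · rintro (⟨x, hx, h⟩ | ⟨x, hx, h⟩)
    · omega
    · rwa [show v = x by omega]
  · exact fun h => Or.inr ⟨v, h, rfl⟩

theorem interleave_injective (hab : a + b = 1) : Function.Injective (interleave a b) := by
  intro p p' h
  refine Prod.ext ?_ ?_ <;> ext x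
  · rw [← mem_interleave_left hab, h, mem_interleave_left hab]
  · rw [← mem_interleave_right hab, h, mem_interleave_right hab]

theorem interleave_surjective (hab : a + b = 1) : Function.Surjective (interleave a b) := by
  intro S
  refine ⟨({x ∈ S | x % 2 = a}.image (· / 2), {x ∈ S | x % 2 = b}.image (· / 2)), ?_⟩
  ext x
  simp only [interleave, mem_union, mem_image, mem_filter]
  constructor
  · rintro (⟨_, ⟨y, ⟨hy, h⟩, rfl⟩, rfl⟩ | ⟨_, ⟨y, ⟨hy, h⟩, rfl⟩, rfl⟩)
    all_goals rwa [← h, Nat.div_add_mod]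
  · intro hx
    have : x % 2 = a ∨ x % 2 = b := by omega
    refine this.imp (fun h => ?_) fun h => ?_
    all_goals exact ⟨x / 2, ⟨x, ⟨hx, h⟩, rfl⟩, by rw [← h, Nat.div_add_mod]⟩

theorem sum_interleave (hab : a + b = 1) (p : Finset ℕ × Finset ℕ) :
    ∑ x ∈ interleave a b p, x = pairWeight a b p := by
  rw [interleave, sum_union, sum_image, sum_image, sum_add_distrib, sum_add_distrib, ← mul_sum,
    ← mul_sum, sum_const, sum_const, pairWeight]
  · simp only [smul_eq_mul]
    ring
  · intro x _ y _ h
    simpa using h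
  · intro x _ y _ h
    simpa using h
  · rw [disjoint_left]
    simp only [mem_image, not_exists, not_and]
    rintro _ ⟨x, -, rfl⟩ y -
    omega

theorem forall_two_le_mem_interleave (hab : a + b = 1) {p : Finset ℕ × Finset ℕ} :
    (∀ x ∈ interleave a b p, 2 ≤ x) ↔ (∀ u ∈ p.1, 1 ≤ u) ∧ ∀ v ∈ p.2, 1 ≤ v := by
  constructor
  · refine fun h => ⟨fun u hu => ?_, fun v hv => ?_⟩
    · have := h _ ((mem_interleave_left hab).mpr hu)
      omega
    · have := h _ ((mem_interleave_right hab).mpr hv)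
      omega
  · rintro ⟨h1, h2⟩ x hx
    simp only [interleave, mem_union, mem_image] at hx
    obtain ⟨u, hu, rfl⟩ | ⟨v, hv, rfl⟩ := hx
    · have := h1 u hu
      omega
    · have := h2 v hv
      omega

theorem card_filter_interleave (hab : a + b = 1) (p : Finset ℕ × Finset ℕ) (u : ℕ)
    (P : ℕ → Prop) [DecidablePred P] (hP : ∀ x, P x ↔ x % 2 = a) :
    ((interleave a b p).val.filter fun y => P y ∧ y ≤ 2 * u + a).card = p.1.rank u := by
  rw [← filter_val, card_val, rank, ← card_image_of_injective {x ∈ p.1 | x ≤ u}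
    (f := fun u => 2 * u + a) fun x y h => by simpa using h]
  congr 1
  ext x
  simp only [mem_filter, hP, mem_image]
  constructor
  · rintro ⟨hx, h, hu⟩
    rw [← Nat.div_add_mod x 2, h, mem_interleave_left hab] at hx
    exact ⟨x / 2, ⟨hx, by omega⟩, by omega⟩
  · rintro ⟨y, ⟨hy, h⟩, rfl⟩
    exact ⟨(mem_interleave_left hab).mpr hy, by omega, by omega⟩

theorem ncard_interleave_eq_coeff (hab : a + b = 1) (n : ℕ) (P : Finset ℕ → Prop)
    (hP : ∀ p : Finset ℕ × Finset ℕ, (∀ u ∈ p.1, 1 ≤ u) → (∀ v ∈ p.2, 1 ≤ v) →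
      (P (interleave a b p) ↔
        ∀ u ∈ p.1, ∀ v ∈ p.2, v + 1 ≠ u + p.1.rank u ∧ v ≠ u + p.1.rank u)) :
    ({S : Finset ℕ | (∀ x ∈ S, 2 ≤ x) ∧ P S ∧ ∑ x ∈ S, x = n}.ncard : ℚ) =
      coeff n (∑ N ∈ range (2 * n + 1), X ^ (N * (N + 1)) * invPochhammer 1 N) := by
  have h1 := isInvPochhammer_invPochhammer one_ne_zero
  rw [pow_one] at h1
  have h2 := isInvPochhammer_invPochhammer two_ne_zero
  have himage : {S : Finset ℕ | (∀ x ∈ S, 2 ≤ x) ∧ P S ∧ ∑ x ∈ S, x = n} =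
      interleave a b '' {p | p ∈ separatedPairs #p.1 #p.2 ∧ pairWeight a b p = n} := by
    ext S
    obtain ⟨p, rfl⟩ := interleave_surjective hab S
    rw [(interleave_injective hab).mem_set_image]
    simp only [Set.mem_ofPred_eq, forall_two_le_mem_interleave hab, sum_interleave hab,
      separatedPairs, true_and]
    constructor
    · rintro ⟨⟨hU, hV⟩, h, hn⟩
      exact ⟨⟨hU, hV, (hP p hU hV).mp h⟩, hn⟩
    · rintro ⟨⟨hU, hV, h⟩, hn⟩
      exact ⟨⟨hU, hV⟩, (hP p hU hV).mpr h, hn⟩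
  have hle {p : Finset ℕ × Finset ℕ}
      (hp : p ∈ {p | p ∈ separatedPairs #p.1 #p.2 ∧ pairWeight a b p = n}) :
      ∑ u ∈ p.1, u ≤ n ∧ ∑ v ∈ p.2, v ≤ n := by
    rw [← hp.2, pairWeight]
    constructor <;> ring_nf <;> omega
  rw [himage, Set.ncard_image_of_injective _ (interleave_injective hab),
    ncard_eq_sum_fiber (((finite_setOf_sum_le n).prod (finite_setOf_sum_le n)).subset fun p hp =>
      ⟨⟨hp.1.2.2.1, (hle hp).1⟩, hp.1.2.2.2.1, (hle hp).2⟩)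
      ((range (2 * n + 1)).sigma antidiagonal) (fun p => ⟨#p.1 + #p.2, #p.1, #p.2⟩),
    sum_sigma, Nat.cast_sum, map_sum]
  · refine sum_congr rfl fun N _ => ?_
    have key : X ^ (N * (N + 1)) * invPochhammer 1 N = ∑ p ∈ antidiagonal N,
        weightSeries (pairWeight a b) (separatedPairs p.1 p.2) := by
      have : invPochhammer 1 N = ∑ p ∈ antidiagonal N,
          X ^ (a * p.1 + b * p.2) * (invPochhammer 2 p.1 * invPochhammer 2 p.2) := by
        obtain ⟨rfl, rfl⟩ | ⟨rfl, rfl⟩ : a = 1 ∧ b = 0 ∨ a = 0 ∧ b = 1 := by omega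
        · simpa using (h1.sum_antidiagonal_pow_fst_mul h2 N).symm
        · rw [← Finset.Nat.sum_antidiagonal_swap]
          rw [← h1.sum_antidiagonal_pow_fst_mul h2 N]
          refine sum_congr rfl fun p _ => ?_
          simp only [Prod.fst_swap, Prod.snd_swap]
          ring
      rw [this, mul_sum]
      refine sum_congr rfl fun p hp => ?_
      rw [weightSeries_separatedPairs h2, mem_antidiagonal.mp hp]
      ring
    rw [key, Nat.cast_sum, map_sum]
    refine sum_congr rfl fun p hp => ?_
    rw [weightSeries, coeff_mk]
    congr 2
    ext q
    obtain ⟨k, m⟩ := p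
    rw [HasAntidiagonal.mem_antidiagonal] at hp
    simp only [Set.mem_ofPred_eq, Sigma.mk.injEq, heq_eq_eq, Prod.mk.injEq]
    constructor
    · rintro ⟨⟨h, hn⟩, -, rfl, rfl⟩
      exact ⟨h, hn⟩
    · rintro ⟨h, hn⟩
      obtain ⟨rfl, rfl⟩ : #q.1 = k ∧ #q.2 = m := ⟨h.1, h.2.1⟩
      exact ⟨⟨h, hn⟩, hp, rfl, rfl⟩
  · intro p hp
    have h1 := card_le_sum_of_one_le hp.1.2.2.1
    have h2 := card_le_sum_of_one_le hp.1.2.2.2.1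
    have h3 := hle hp
    simp only [mem_sigma, mem_range, HasAntidiagonal.mem_antidiagonal, and_true]
    omega

end Interleave

theorem ncard_odd_separated_eq_coeff (n : ℕ) :
    ({S : Finset ℕ | (∀ x ∈ S, 2 ≤ x) ∧ (∀ x ∈ S.val, Odd x →
        x + 2 * (S.val.filter (fun y => Odd y ∧ y ≤ x)).card - 3 ∉ S.val ∧
        x + 2 * (S.val.filter (fun y => Odd y ∧ y ≤ x)).card - 1 ∉ S.val) ∧
      ∑ x ∈ S, x = n}.ncard : ℚ) =
      PowerSeries.coeff n
        (∑ N ∈ range (2 * n + 1), PowerSeries.X ^ (N * (N + 1)) * invPochhammer 1 N) := by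
  refine ncard_interleave_eq_coeff (a := 1) (b := 0) rfl n (fun S => ∀ x ∈ S.val, Odd x →
        x + 2 * (S.val.filter (fun y => Odd y ∧ y ≤ x)).card - 3 ∉ S.val ∧
        x + 2 * (S.val.filter (fun y => Odd y ∧ y ≤ x)).card - 1 ∉ S.val) fun p hU hV => ?_
  have hcard (u : ℕ) := card_filter_interleave (a := 1) (b := 0) rfl p u Odd fun x => Nat.odd_iff
  constructor
  · intro h u hu v hv
    have hr := rank_pos hu
    have h' := h (2 * u + 1) ((mem_interleave_left rfl).mpr hu) ⟨u, rfl⟩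
    rw [hcard] at h'
    constructor
    · intro e
      refine h'.1 ?_
      rw [show 2 * u + 1 + 2 * p.1.rank u - 3 = 2 * v + 0 by omega]
      exact (mem_interleave_right rfl).mpr hv
    · intro e
      refine h'.2 ?_
      rw [show 2 * u + 1 + 2 * p.1.rank u - 1 = 2 * v + 0 by omega]
      exact (mem_interleave_right rfl).mpr hv
  · rintro h _ hx ⟨u, rfl⟩
    have hu : u ∈ p.1 := (mem_interleave_left rfl).mp hx
    have hr := rank_pos hu
    rw [hcard]
    constructor
    · intro hm
      rw [show 2 * u + 1 + 2 * p.1.rank u - 3 = 2 * (u + p.1.rank u - 1) + 0 by omega] at hm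
      have := (h u hu _ ((mem_interleave_right rfl).mp hm)).1
      omega
    · intro hm
      rw [show 2 * u + 1 + 2 * p.1.rank u - 1 = 2 * (u + p.1.rank u) + 0 by omega] at hm
      exact (h u hu _ ((mem_interleave_right rfl).mp hm)).2 rfl

theorem ncard_even_separated_eq_coeff (n : ℕ) :
    ({S : Finset ℕ | (∀ x ∈ S, 2 ≤ x) ∧ (∀ x ∈ S.val, Even x →
        x + 2 * (S.val.filter (fun y => Even y ∧ y ≤ x)).card - 1 ∉ S.val ∧
        x + 2 * (S.val.filter (fun y => Even y ∧ y ≤ x)).card + 1 ∉ S.val) ∧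
      ∑ x ∈ S, x = n}.ncard : ℚ) =
      PowerSeries.coeff n
        (∑ N ∈ range (2 * n + 1), PowerSeries.X ^ (N * (N + 1)) * invPochhammer 1 N) := by
  refine ncard_interleave_eq_coeff (a := 0) (b := 1) rfl n (fun S => ∀ x ∈ S.val, Even x →
        x + 2 * (S.val.filter (fun y => Even y ∧ y ≤ x)).card - 1 ∉ S.val ∧
        x + 2 * (S.val.filter (fun y => Even y ∧ y ≤ x)).card + 1 ∉ S.val) fun p hU hV => ?_
  have hcard (u : ℕ) := card_filter_interleave (a := 0) (b := 1) rfl p u Even fun x => Nat.even_iff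
  simp only [add_zero] at hcard
  constructor
  · intro h u hu v hv
    have hr := rank_pos hu
    have h' := h (2 * u) ((mem_interleave_left (a := 0) (b := 1) rfl).mpr hu) (even_two_mul u)
    rw [hcard] at h'
    constructor
    · intro e
      refine h'.1 ?_
      rw [show 2 * u + 2 * p.1.rank u - 1 = 2 * v + 1 by omega]
      exact (mem_interleave_right rfl).mpr hv
    · intro e
      refine h'.2 ?_
      rw [show 2 * u + 2 * p.1.rank u + 1 = 2 * v + 1 by omega]
      exact (mem_interleave_right rfl).mpr hv
  · intro h x hx he
    obtain ⟨u, rfl⟩ := even_iff_exists_two_mul.mp he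
    have hu : u ∈ p.1 := (mem_interleave_left (a := 0) (b := 1) rfl).mp hx
    have hr := rank_pos hu
    rw [hcard]
    constructor
    · intro hm
      rw [show 2 * u + 2 * p.1.rank u - 1 = 2 * (u + p.1.rank u - 1) + 1 by omega] at hm
      have := (h u hu _ ((mem_interleave_right rfl).mp hm)).1
      omega
    · intro hm
      rw [show 2 * u + 2 * p.1.rank u + 1 = 2 * (u + p.1.rank u) + 1 by omega] at hm
      exact (h u hu _ ((mem_interleave_right rfl).mp hm)).2 rfl

end Partition

end

/-- the counts `A(n)`, `B(n)`, `C(n)`, `D(n)` associated with the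
second Rogers–Ramanujan identity all coincide.  Here, for `x` the `j`-th odd
(resp. even) part of a distinct-part partition listed in ascending order,
`j` is realized as the number of odd (resp. even) parts `≤ x`. -/
theorem rogers_ramanujan_two_four_ways (n : ℕ) (hn : 0 < n) :
    -- A(n): distinct parts, no 1's, gap of at least 2 between consecutive parts
    (Nat.card {p : Nat.Partition n // p.parts.Nodup ∧ 1 ∉ p.parts ∧
        ∀ x ∈ p.parts, ∀ y ∈ p.parts, x < y → x + 2 ≤ y} =
      -- B(n): parts ≡ 2, 3 (mod 5)
      Nat.card {p : Nat.Partition n // ∀ x ∈ p.parts, x % 5 = 2 ∨ x % 5 = 3}) ∧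
    -- B(n) = C(n)
    (Nat.card {p : Nat.Partition n // ∀ x ∈ p.parts, x % 5 = 2 ∨ x % 5 = 3} =
      Nat.card {p : Nat.Partition n // p.parts.Nodup ∧ 1 ∉ p.parts ∧
        ∀ x ∈ p.parts, Odd x →
          x + 2 * (p.parts.filter (fun y => Odd y ∧ y ≤ x)).card - 3 ∉ p.parts ∧
          x + 2 * (p.parts.filter (fun y => Odd y ∧ y ≤ x)).card - 1 ∉ p.parts}) ∧
    -- C(n) = D(n)
    (Nat.card {p : Nat.Partition n // p.parts.Nodup ∧ 1 ∉ p.parts ∧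
        ∀ x ∈ p.parts, Odd x →
          x + 2 * (p.parts.filter (fun y => Odd y ∧ y ≤ x)).card - 3 ∉ p.parts ∧
          x + 2 * (p.parts.filter (fun y => Odd y ∧ y ≤ x)).card - 1 ∉ p.parts} =
      Nat.card {p : Nat.Partition n // p.parts.Nodup ∧ 1 ∉ p.parts ∧
        ∀ x ∈ p.parts, Even x →
          x + 2 * (p.parts.filter (fun y => Even y ∧ y ≤ x)).card - 1 ∉ p.parts ∧
          x + 2 * (p.parts.filter (fun y => Even y ∧ y ≤ x)).card + 1 ∉ p.parts}) := by
  have hB : (Nat.card {p : Nat.Partition n // ∀ x ∈ p.parts, x % 5 = 2 ∨ x % 5 = 3} : ℚ) =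
      PowerSeries.coeff n (∑ N ∈ Finset.range (2 * n + 1),
        PowerSeries.X ^ (N * (N + 1)) * invPochhammer 1 N) := by
    rw [Nat.Partition.card_subtype_eq_ncard n fun M => ∀ x ∈ M, x % 5 = 2 ∨ x % 5 = 3,
      coeff_sum_pow_mul_invPochhammer]
    congr 2
    ext M
    refine and_iff_right_of_imp fun hM h0 => ?_
    have := hM.1 0 h0
    omega
  have hA := ncard_gap_eq_coeff n
  have hC := ncard_odd_separated_eq_coeff n
  have hD := ncard_even_separated_eq_coeff n
  rw [← Nat.Partition.card_nodup_eq_ncard n fun M => ∀ x ∈ M, Odd x →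
    x + 2 * (M.filter (fun y => Odd y ∧ y ≤ x)).card - 3 ∉ M ∧
    x + 2 * (M.filter (fun y => Odd y ∧ y ≤ x)).card - 1 ∉ M] at hC
  rw [← Nat.Partition.card_nodup_eq_ncard n fun M => ∀ x ∈ M, Even x →
    x + 2 * (M.filter (fun y => Even y ∧ y ≤ x)).card - 1 ∉ M ∧
    x + 2 * (M.filter (fun y => Even y ∧ y ≤ x)).card + 1 ∉ M] at hD
  refine ⟨?_, ?_, ?_⟩
  · rw [Nat.Partition.card_nodup_eq_ncard n fun M => ∀ x ∈ M, ∀ y ∈ M, x < y → x + 2 ≤ y]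
    exact_mod_cast hA.trans hB.symm
  · exact_mod_cast hB.trans hC.symm
  · exact_mod_cast hC.trans hD.symm
end

section
/- For a positive integer n, let A(n) denote the number of partitions of n into distinct parts with a gap of at least 2 between consecutive parts, let B(n) denote the number of partitions of n into parts congruent to 1 or 4 modulo 5, let C(n) denote the number of partitions of n into distinct parts such that, if o_1 < o_2 < ⋯ are the odd parts listed in ascending order, then for each j neither o_j + 2j − 3 nor o_j + 2j − 1 is a part, and let D(n) denote the number of partitions of n into distinct parts such that, if e_1 < e_2 < ⋯ are the even parts listed in ascending order, then for each j neither e_j + 2j − 3 nor e_j + 2j − 1 is a part. Then A(n) = B(n) = C(n) = D(n). -/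
namespace RogersRamanujan

open Finset PowerSeries

section Recurrence

variable {R : Type*} [CommRing R] {q : R} {r : ℤ → R}

/-- `r n` behaves like the reciprocal `1 / (q; q)_n`, extended by zero to negative `n`. -/
structure IsInvPochhammer (q : R) (r : ℤ → R) : Prop where
  zero : r 0 = 1
  neg : ∀ n < 0, r n = 0
  step : ∀ n : ℤ, (1 - q ^ n.toNat) * r n = r (n - 1)
  isUnit : ∀ n : ℕ, IsUnit (1 - q ^ (n + 1))

theorem IsInvPochhammer.step_of_eq (h : IsInvPochhammer q r) {n : ℤ} {k : ℕ} (hk : n = k) :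
    (1 - q ^ k) * r n = r (n - 1) := by
  subst hk; simpa using h.step k

theorem sum_Icc_shift {M : ℤ} {g : ℤ → R} (h₁ : g (-M) = 0) (h₂ : g (M + 1) = 0) :
    ∑ j ∈ Icc (-M) M, g (j + 1) = ∑ j ∈ Icc (-M) M, g j := by
  have e : ∑ j ∈ Icc (-M) M, g (j + 1) = ∑ j ∈ Icc (-M + 1) (M + 1), g j := by
    rw [← Finset.map_add_right_Icc, Finset.sum_map]; rfl
  rw [e, Finset.sum_subset (s₂ := Icc (-M) (M + 1)),
    Finset.sum_subset (s₁ := Icc (-M) M) (s₂ := Icc (-M) (M + 1))]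
  · intro x hx; simp only [Finset.mem_Icc] at *; omega
  · intro x hx hx'
    obtain rfl : x = M + 1 := by simp only [Finset.mem_Icc] at *; omega
    exact h₂
  · intro x hx; simp only [Finset.mem_Icc] at *; omega
  · intro x hx hx'
    obtain rfl : x = -M := by simp only [Finset.mem_Icc] at *; omega
    exact h₁

theorem triple_sum_step (h : IsInvPochhammer q r) {a : R} {e : ℤ → R}
    (he : ∀ (j : ℤ) (m k : ℕ), j + k = m → e (j + 1) * q ^ k = -(a * q ^ m * e j))
    {M : ℤ} {m n : ℕ} (hm : m < M) (hn : n ≤ M) :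
    (1 - q ^ (m + n + 1)) * ∑ j ∈ Icc (-M) M, e j * (r ((m + 1 : ℕ) - j) * r (n + j)) =
      (1 - a * q ^ m) * ∑ j ∈ Icc (-M) M, e j * (r (m - j) * r (n + j)) := by
  set g : ℤ → R := fun j => e j * (q ^ ((m : ℤ) + 1 - j).toNat * (r (m + 1 - j) * r (n + j - 1)))
    with hg
  have key : ∑ j ∈ Icc (-M) M, g (j + 1) = ∑ j ∈ Icc (-M) M, g j := by
    apply sum_Icc_shift
    · simp [hg, h.neg (n + -M - 1) (by omega)]
    · simp [hg, h.neg (m - M) (by omega)]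
  have h1 : (1 - q ^ (m + n + 1)) * ∑ j ∈ Icc (-M) M, e j * (r ((m + 1 : ℕ) - j) * r (n + j)) =
      ∑ j ∈ Icc (-M) M, (e j * (r (m - j) * r (n + j)) + g j) := by
    rw [Finset.mul_sum]
    refine Finset.sum_congr rfl fun j _ => ?_
    simp only [hg, Nat.cast_add, Nat.cast_one]
    by_cases c1 : (m : ℤ) + 1 - j < 0
    · rw [h.neg _ c1, h.neg (m - j) (by omega)]; ring
    by_cases c2 : (n : ℤ) + j < 0
    · rw [h.neg _ c2, h.neg (n + j - 1) (by omega)]; ring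
    obtain ⟨k, hk⟩ := Int.eq_ofNat_of_zero_le (not_lt.1 c1)
    obtain ⟨l, hl⟩ := Int.eq_ofNat_of_zero_le (not_lt.1 c2)
    have e1 := h.step_of_eq hk
    have e2 := h.step_of_eq hl
    rw [show (m : ℤ) + 1 - j - 1 = m - j by ring] at e1
    rw [← e1, ← e2, hk, Int.toNat_natCast, show m + n + 1 = k + l by omega]
    ring
  rw [h1, Finset.sum_add_distrib, ← key, ← Finset.sum_add_distrib, Finset.mul_sum]
  refine Finset.sum_congr rfl fun j _ => ?_
  simp only [hg]
  rw [show (m : ℤ) + 1 - (j + 1) = m - j by ring, show (n : ℤ) + (j + 1) - 1 = n + j by ring]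
  by_cases c1 : (m : ℤ) - j < 0
  · rw [h.neg _ c1]; ring
  obtain ⟨k, hk⟩ := Int.eq_ofNat_of_zero_le (not_lt.1 c1)
  rw [hk, Int.toNat_natCast]
  have := he j m k (by omega)
  linear_combination (r k * r (n + j)) * this

theorem sum_Icc_neg (M : ℤ) (g : ℤ → R) :
    ∑ j ∈ Icc (-M) M, g (-j) = ∑ j ∈ Icc (-M) M, g j := by
  refine Finset.sum_nbij' (fun j => -j) (fun j => -j) ?_ ?_ ?_ ?_ ?_ <;>
    intro x hx <;> simp only [Finset.mem_Icc, neg_neg] at * <;> omega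

/-- A finite form of the Jacobi triple product identity. -/
theorem finite_triple_product (h : IsInvPochhammer q r) {a b : R} {e : ℤ → R} (e0 : e 0 = 1)
    (he : ∀ (j : ℤ) (m k : ℕ), j + k = m → e (j + 1) * q ^ k = -(a * q ^ m * e j))
    (he' : ∀ (j : ℤ) (m k : ℕ), -j + k = m → e (j - 1) * q ^ k = -(b * q ^ m * e j))
    {M : ℤ} {m n : ℕ} (hm : m ≤ M) (hn : n ≤ M) :
    ∑ j ∈ Icc (-M) M, e j * (r (m - j) * r (n + j)) =
      r ((m + n : ℕ)) * ((∏ i ∈ range m, (1 - a * q ^ i)) * ∏ i ∈ range n, (1 - b * q ^ i)) := by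
  induction m with
  | zero =>
    induction n with
    | zero =>
      rw [Finset.sum_eq_single 0]
      · simp [h.zero, e0]
      · intro j _ hj
        rcases lt_or_gt_of_ne hj with hj | hj
        · rw [h.neg (((0 : ℕ) : ℤ) + j) (by simpa)]; ring
        · rw [h.neg (((0 : ℕ) : ℤ) - j) (by simpa)]; ring
      · intro h0; simp at h0; omega
    | succ n ih =>
      have ih := ih (by omega)
      apply (h.isUnit n).mul_left_cancel
      have st := triple_sum_step (e := fun j => e (-j)) (a := b) (M := M) (m := n) (n := 0) h
        (by
          intro j m k hk
          have := he' (-j) m k (by omega)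
          rwa [show -j - 1 = -(j + 1) by ring] at this) (by omega) (by omega)
      have s1 : ∀ n : ℕ, ∑ j ∈ Icc (-M) M, e j * (r ((0 : ℕ) - j) * r (n + j)) =
          ∑ j ∈ Icc (-M) M, e (-j) * (r (n - j) * r ((0 : ℕ) + j)) := by
        intro n
        rw [← sum_Icc_neg]
        refine Finset.sum_congr rfl fun j _ => ?_
        rw [sub_neg_eq_add, ← sub_eq_add_neg, mul_comm (r _)]
      rw [s1, show n + 1 = n + 0 + 1 by ring]
      refine st.trans ?_
      rw [← s1, ih, Finset.prod_range_succ _ (n + 0)]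
      have := h.step_of_eq (n := ((0 + (n + 0 + 1) : ℕ) : ℤ)) (k := n + 1) (by simp)
      rw [show ((0 + (n + 0 + 1) : ℕ) : ℤ) - 1 = ((0 + n : ℕ) : ℤ) by push_cast; ring] at this
      rw [← this]; simp only [add_zero]; ring
  | succ m ih =>
    have ih := ih (by omega)
    apply (h.isUnit (m + n)).mul_left_cancel
    rw [triple_sum_step h he (by omega) hn, ih, Finset.prod_range_succ _ m]
    have := h.step_of_eq (n := ((m + 1 + n : ℕ) : ℤ)) (k := m + n + 1) (by push_cast; ring)
    rw [show ((m + 1 + n : ℕ) : ℤ) - 1 = ((m + n : ℕ) : ℤ) by push_cast; ring] at this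
    rw [← this]; ring

theorem vandermonde_limit (h : IsInvPochhammer q r) (N a : ℕ) :
    ∑ t ∈ range (N + 1), q ^ (t ^ 2 + a * t) * (r t * r (N - t) * r (t + a)) =
      r N * r (N + a) := by
  induction N generalizing a with
  | zero => simp [h.zero]
  | succ N ih =>
    apply (h.isUnit N).mul_left_cancel
    have e1 := h.step_of_eq (n := ((N + 1 : ℕ) : ℤ)) (k := N + 1) rfl
    rw [← mul_assoc, e1]
    have ih := ih (a + 1)
    have ih' : r (((N + 1 : ℕ) : ℤ) - 1) * r ((N + 1 : ℕ) + a) = r N * r (N + (a + 1 : ℕ)) := by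
      congr 2 <;> push_cast <;> ring
    rw [ih', ← ih, Finset.mul_sum]
    have h1 : ∀ t ∈ range (N + 1 + 1), (1 - q ^ (N + 1)) *
        (q ^ (t ^ 2 + a * t) * (r t * r ((N + 1 : ℕ) - t) * r (t + a))) =
        q ^ (t ^ 2 + a * t) * (r (t - 1) * r ((N + 1 : ℕ) - t) * r (t + a)) +
        q ^ (t ^ 2 + a * t + t) * (r t * r (N - t) * r (t + a)) := by
      intro t ht
      rw [Finset.mem_range] at ht
      have e2 := h.step_of_eq (n := t) (k := t) rfl
      have e3 := h.step_of_eq (n := ((N + 1 : ℕ) : ℤ) - t) (k := N + 1 - t) (by omega)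
      rw [show ((N + 1 : ℕ) : ℤ) - t - 1 = N - t by push_cast; ring] at e3
      rw [← e2, ← e3]
      obtain ⟨k, hk⟩ := Nat.exists_eq_add_of_le (Nat.lt_succ_iff.1 ht)
      rw [hk, Nat.add_sub_cancel_left]
      ring
    rw [Finset.sum_congr rfl h1, Finset.sum_add_distrib, Finset.sum_range_succ',
      Finset.sum_range_succ _ (N + 1)]
    rw [h.neg (((0 : ℕ) : ℤ) - 1) (by simp), h.neg ((N : ℤ) - (N + 1 : ℕ)) (by simp)]
    simp only [zero_mul, mul_zero, add_zero]
    rw [← Finset.sum_add_distrib]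
    refine Finset.sum_congr rfl fun t _ => ?_
    have e4 := h.step_of_eq (n := (t : ℤ) + (a + 1 : ℕ)) (k := t + a + 1) (by push_cast; ring)
    rw [show (t : ℤ) + (a + 1 : ℕ) - 1 = t + a by push_cast; ring] at e4
    rw [show ((t + 1 : ℕ) : ℤ) - 1 = t by push_cast; ring,
      show ((N + 1 : ℕ) : ℤ) - (t + 1 : ℕ) = N - t by push_cast; ring,
      show ((t + 1 : ℕ) : ℤ) + a = t + (a + 1 : ℕ) by push_cast; ring, ← e4]
    ring

theorem bailey_kernel (h : IsInvPochhammer q r) (N : ℕ) (j : ℤ) :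
    ∑ s ∈ range (N + 1), q ^ (s ^ 2) * (r (N - s) * (r (s - j) * r (s + j))) =
      q ^ (j.natAbs ^ 2) * (r (N - j) * r (N + j)) := by
  wlog hj : 0 ≤ j generalizing j
  · have := this (-j) (by omega)
    simp only [sub_neg_eq_add, ← sub_eq_add_neg, Int.natAbs_neg] at this
    simp only [mul_comm (r (_ - j))]
    exact this
  obtain ⟨j, rfl⟩ := Int.eq_ofNat_of_zero_le hj
  simp only [Int.natAbs_natCast]
  by_cases hjN : N < j
  · rw [h.neg ((N : ℤ) - j) (by omega), Finset.sum_eq_zero]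
    · ring
    · intro s hs
      rw [Finset.mem_range] at hs
      rw [h.neg ((s : ℤ) - j) (by omega)]; ring
  · obtain ⟨k, rfl⟩ := Nat.exists_eq_add_of_le (not_lt.1 hjN)
    rw [add_assoc, Finset.sum_range_add, Finset.sum_eq_zero, zero_add]
    · have := vandermonde_limit h k (2 * j)
      rw [show ((j + k : ℕ) : ℤ) - j = k by push_cast; ring,
        show ((j + k : ℕ) : ℤ) + j = k + (2 * j : ℕ) by push_cast; ring, ← this, Finset.mul_sum]
      refine Finset.sum_congr rfl fun t _ => ?_
      rw [show ((j + k : ℕ) : ℤ) - (j + t : ℕ) = k - t by push_cast; ring,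
        show ((j + t : ℕ) : ℤ) - j = t by push_cast; ring,
        show ((j + t : ℕ) : ℤ) + j = t + (2 * j : ℕ) by push_cast; ring]
      ring
    · intro s hs
      rw [Finset.mem_range] at hs
      rw [h.neg ((s : ℤ) - j) (by omega)]; ring

/-- One step along the Bailey chain with parameter `1`. -/
theorem bailey_step (h : IsInvPochhammer q r) {S : Finset ℤ} {α : ℤ → R} {β : ℕ → R} {N : ℕ}
    (hβ : ∀ s ≤ N, ∑ j ∈ S, α j * (r (s - j) * r (s + j)) = β s) :
    ∑ j ∈ S, α j * q ^ (j.natAbs ^ 2) * (r (N - j) * r (N + j)) =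
      ∑ s ∈ range (N + 1), q ^ (s ^ 2) * (r (N - s) * β s) := by
  have : ∀ s ∈ range (N + 1), q ^ (s ^ 2) * (r (N - s) * β s) =
      ∑ j ∈ S, α j * (q ^ (s ^ 2) * (r (N - s) * (r (s - j) * r (s + j)))) := by
    intro s hs
    rw [← hβ s (by simpa [Nat.lt_succ_iff] using hs), Finset.mul_sum, Finset.mul_sum]
    exact Finset.sum_congr rfl fun j _ => by ring
  rw [Finset.sum_congr rfl this, Finset.sum_comm]
  refine Finset.sum_congr rfl fun j _ => ?_
  rw [← Finset.mul_sum, bailey_kernel h]; ring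

end Recurrence

section Exponents

theorem neg_one_pow_natAbs_add_one {R : Type*} [CommRing R] (j : ℤ) :
    (-1 : R) ^ (j + 1).natAbs = -(-1) ^ j.natAbs := by
  rcases lt_or_ge j 0 with h | h
  · rw [show j.natAbs = (j + 1).natAbs + 1 by omega]; ring
  · rw [show (j + 1).natAbs = j.natAbs + 1 by omega]; ring

theorem neg_one_pow_natAbs_sub_one {R : Type*} [CommRing R] (j : ℤ) :
    (-1 : R) ^ (j - 1).natAbs = -(-1) ^ j.natAbs := by
  have := neg_one_pow_natAbs_add_one (R := R) (j - 1)
  rw [sub_add_cancel] at this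
  rw [this, neg_neg]

theorem two_mul_toNat_triangular (j : ℤ) :
    2 * ((j * (j - 1) / 2).toNat : ℤ) = j * (j - 1) := by
  have h : 2 ∣ j * (j - 1) := (Int.even_mul_pred_self j).two_dvd
  have h' : 0 ≤ j * (j - 1) := by rcases lt_trichotomy j 0 with h | h | h <;> nlinarith
  rw [Int.toNat_of_nonneg (by positivity), Int.mul_ediv_cancel' h]

theorem two_mul_toNat_pentagonal (j : ℤ) :
    2 * ((j * (5 * j - 1) / 2).toNat : ℤ) = j * (5 * j - 1) := by
  have h : 2 ∣ j * (5 * j - 1) := by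
    rw [show j * (5 * j - 1) = j * (j - 1) + 2 * (2 * j ^ 2) by ring]
    exact dvd_add (Int.even_mul_pred_self j).two_dvd (dvd_mul_right _ _)
  have h' : 0 ≤ j * (5 * j - 1) := by rcases lt_trichotomy j 0 with h | h | h <;> nlinarith
  rw [Int.toNat_of_nonneg (by positivity), Int.mul_ediv_cancel' h]

end Exponents

section Identities

variable {R : Type*} [CommRing R] {q : R} {r : ℤ → R}

theorem sum_sq_eq_alternating_sum (h : IsInvPochhammer q r) (N : ℕ) :
    ∑ s ∈ range (N + 1), q ^ (s ^ 2) * (r (N - s) * r s) =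
      ∑ j ∈ Icc (-N : ℤ) N,
        (-1) ^ j.natAbs * q ^ (j * (5 * j - 1) / 2).toNat * (r (N - j) * r (N + j)) := by
  have base : ∀ s ≤ N, ∑ j ∈ Icc (-N : ℤ) N,
      (-1) ^ j.natAbs * q ^ (j * (j - 1) / 2).toNat * (r (s - j) * r (s + j)) =
      if s = 0 then 1 else 0 := by
    intro s hs
    rw [finite_triple_product h (a := 1) (b := q) (by simp) _ _ (by omega) (by omega)]
    · rcases s with _ | s
      · simp [h.zero]
      · rw [Finset.prod_range_succ']; simp
    · intro j m k hk
      have h1 := two_mul_toNat_triangular j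
      have h2 := two_mul_toNat_triangular (j + 1)
      rw [neg_one_pow_natAbs_add_one, mul_assoc, ← pow_add, one_mul, mul_left_comm, ← pow_add,
        ← neg_mul, show ((j + 1) * (j + 1 - 1) / 2).toNat + k = m + (j * (j - 1) / 2).toNat by
          zify; linarith]
    · intro j m k hk
      have h1 := two_mul_toNat_triangular j
      have h2 := two_mul_toNat_triangular (j - 1)
      rw [neg_one_pow_natAbs_sub_one, mul_assoc, ← pow_add, ← pow_succ', mul_left_comm, ← pow_add,
        ← neg_mul, show ((j - 1) * (j - 1 - 1) / 2).toNat + k = m + 1 + (j * (j - 1) / 2).toNat by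
          zify; linarith]
  have first : ∀ s ≤ N, ∑ j ∈ Icc (-N : ℤ) N,
      (-1) ^ j.natAbs * q ^ (j * (j - 1) / 2).toNat * q ^ (j.natAbs ^ 2) *
        (r (s - j) * r (s + j)) = r s := by
    intro s hs
    rw [bailey_step h (fun t ht => base t (ht.trans hs)), Finset.sum_range_succ']
    simp
  rw [← bailey_step h first]
  refine Finset.sum_congr rfl fun j _ => ?_
  congr 1
  rw [mul_assoc, mul_assoc, ← pow_add, ← pow_add]
  congr 2
  zify
  have h1 := two_mul_toNat_triangular j
  have h2 := two_mul_toNat_pentagonal j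
  rw [sq_abs]
  linarith

theorem alternating_sum_eq_prod (h : IsInvPochhammer (q ^ 5) r) (N : ℕ) :
    ∑ j ∈ Icc (-N : ℤ) N,
        (-1) ^ j.natAbs * q ^ (j * (5 * j - 1) / 2).toNat * (r (N - j) * r (N + j)) =
      r ((N + N : ℕ)) * ((∏ i ∈ range N, (1 - q ^ (5 * i + 2))) *
        ∏ i ∈ range N, (1 - q ^ (5 * i + 3))) := by
  rw [finite_triple_product h (a := q ^ 2) (b := q ^ 3) (by simp) _ _ le_rfl le_rfl]
  · simp only [← pow_mul, ← pow_add, add_comm]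
  · intro j m k hk
    have h1 := two_mul_toNat_pentagonal j
    have h2 := two_mul_toNat_pentagonal (j + 1)
    rw [neg_one_pow_natAbs_add_one, ← pow_mul, ← pow_mul, ← pow_add, mul_assoc, ← pow_add,
      mul_left_comm, ← pow_add, ← neg_mul,
      show ((j + 1) * (5 * (j + 1) - 1) / 2).toNat + 5 * k =
        2 + 5 * m + (j * (5 * j - 1) / 2).toNat by zify; linarith]
  · intro j m k hk
    have h1 := two_mul_toNat_pentagonal j
    have h2 := two_mul_toNat_pentagonal (j - 1)
    rw [neg_one_pow_natAbs_sub_one, ← pow_mul, ← pow_mul, ← pow_add, mul_assoc, ← pow_add,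
      mul_left_comm, ← pow_add, ← neg_mul,
      show ((j - 1) * (5 * (j - 1) - 1) / 2).toNat + 5 * k =
        3 + 5 * m + (j * (5 * j - 1) / 2).toNat by zify; linarith]

end Identities

/-- The power series `1 / (q ^ m; q ^ m)_n`, extended by zero to negative `n`. -/
noncomputable def invPoch (m : ℕ) (n : ℤ) : ℚ⟦X⟧ :=
  if n < 0 then 0 else ∏ i ∈ range n.toNat, (1 - (X ^ m) ^ (i + 1))⁻¹

theorem constantCoeff_one_sub_X_pow {m : ℕ} (hm : 0 < m) (n : ℕ) :
    constantCoeff (1 - (X ^ m) ^ (n + 1) : ℚ⟦X⟧) ≠ 0 := by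
  simp [hm.ne']

theorem isInvPochhammer_invPoch {m : ℕ} (hm : 0 < m) :
    IsInvPochhammer (X ^ m : ℚ⟦X⟧) (invPoch m) where
  zero := by simp [invPoch]
  neg n hn := by simp [invPoch, hn]
  step n := by
    rcases lt_trichotomy n 0 with hn | rfl | hn
    · simp [invPoch, hn, hn.trans]
    · simp [invPoch]
    · obtain ⟨k, rfl⟩ : ∃ k : ℕ, n = k + 1 := ⟨(n - 1).toNat, by omega⟩
      have h1 : ¬ ((k : ℤ) + 1 < 0) := by omega
      have h2 : ((k : ℤ) + 1).toNat = k + 1 := by omega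
      simp only [invPoch, h1, h2, if_false, add_sub_cancel_right, Int.toNat_natCast,
        Finset.prod_range_succ, not_lt.2 (Int.natCast_nonneg k)]
      rw [mul_left_comm, PowerSeries.mul_inv_cancel _ (constantCoeff_one_sub_X_pow hm k), mul_one]
  isUnit n := by
    rw [PowerSeries.isUnit_iff_constantCoeff]
    exact (constantCoeff_one_sub_X_pow hm n).isUnit

theorem invPoch_mul_prod {m : ℕ} (hm : 0 < m) (n : ℕ) :
    invPoch m n * ∏ i ∈ range n, (1 - (X ^ m) ^ (i + 1)) = 1 := by
  rw [invPoch, if_neg (by omega), Int.toNat_natCast, ← Finset.prod_mul_distrib]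
  exact Finset.prod_eq_one fun i _ =>
    PowerSeries.inv_mul_cancel _ (constantCoeff_one_sub_X_pow hm i)

/-- Reduction of power series modulo `X ^ (N + 1)`. -/
noncomputable abbrev reduce (N : ℕ) : ℚ⟦X⟧ →+* ℚ⟦X⟧ ⧸ Ideal.span {(X : ℚ⟦X⟧) ^ (N + 1)} :=
  Ideal.Quotient.mk _

theorem reduce_eq_iff {N : ℕ} {f g : ℚ⟦X⟧} :
    reduce N f = reduce N g ↔ ∀ n ≤ N, coeff n f = coeff n g := by
  rw [Ideal.Quotient.eq, Ideal.mem_span_singleton, PowerSeries.X_pow_dvd_iff]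
  simp [sub_eq_zero]

theorem reduce_X_pow {N k : ℕ} (h : N < k) : reduce N (X ^ k) = 0 := by
  rw [Ideal.Quotient.eq_zero_iff_mem, Ideal.mem_span_singleton]
  exact pow_dvd_pow _ h

theorem reduce_X_pow_mul_invPoch {m : ℕ} (hm : 0 < m) {N k n : ℕ} (d : ℕ) (h : N ≤ k + n) :
    reduce N (X ^ k * invPoch m n) = reduce N (X ^ k * invPoch m (n + d : ℕ)) := by
  induction d with
  | zero => rfl
  | succ d ih =>
    have := (isInvPochhammer_invPoch hm).step_of_eq (n := ((n + d + 1 : ℕ) : ℤ)) rfl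
    rw [show ((n + d + 1 : ℕ) : ℤ) - 1 = (n + d : ℕ) by push_cast; ring] at this
    rw [ih, ← this, ← add_assoc, ← mul_assoc, mul_sub, mul_one, sub_mul, map_sub, ← pow_mul,
      ← pow_add, map_mul (reduce N) (X ^ (k + m * (n + d + 1))), reduce_X_pow, zero_mul, sub_zero]
    nlinarith

theorem reduce_invPoch {m : ℕ} (hm : 0 < m) {N n : ℕ} (h : N ≤ n) :
    reduce N (invPoch m n) = reduce N (invPoch m N) := by
  obtain ⟨d, rfl⟩ := Nat.exists_eq_add_of_le h
  simpa using (reduce_X_pow_mul_invPoch (k := 0) hm d (by omega : N ≤ 0 + N)).symm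

theorem reduce_alternating_sum {m : ℕ} (hm : 0 < m) (N : ℕ) :
    reduce N (∑ j ∈ Icc (-N : ℤ) N,
        (-1) ^ j.natAbs * X ^ (j * (5 * j - 1) / 2).toNat *
          (invPoch m (N - j) * invPoch m (N + j))) =
      reduce N (invPoch m N) * (reduce N (invPoch m N) *
      reduce N (∑ j ∈ Icc (-N : ℤ) N, (-1) ^ j.natAbs * X ^ (j * (5 * j - 1) / 2).toNat)) := by
  rw [map_sum, map_sum, Finset.mul_sum, Finset.mul_sum]
  refine Finset.sum_congr rfl fun j hj => ?_
  rw [Finset.mem_Icc] at hj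
  have key : invPoch m (N - j) * invPoch m (N + j) =
      invPoch m (N - j.natAbs : ℕ) * invPoch m (N + j.natAbs : ℕ) := by
    rcases Int.natAbs_eq j with h | h
    · congr 2 <;> omega
    · rw [mul_comm]; congr 2 <;> omega
  have hE : j.natAbs ≤ (j * (5 * j - 1) / 2).toNat := by
    have : j ≤ j * (5 * j - 1) / 2 ∧ -j ≤ j * (5 * j - 1) / 2 := by
      constructor
      · rw [Int.le_ediv_iff_mul_le (by norm_num)]
        rcases lt_trichotomy j 0 with h | h | h <;> nlinarith
      · rw [Int.le_ediv_iff_mul_le (by norm_num)]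
        rcases lt_trichotomy j 0 with h | h | h <;> nlinarith
    omega
  have e1 := reduce_X_pow_mul_invPoch hm (N := N) (k := (j * (5 * j - 1) / 2).toNat)
    (n := N - j.natAbs) j.natAbs (by omega)
  rw [show N - j.natAbs + j.natAbs = N by omega] at e1
  rw [key, mul_assoc, ← mul_assoc (X ^ _), map_mul, map_mul, e1,
    reduce_invPoch hm (Nat.le_add_right N _)]
  simp only [map_mul]
  ring

theorem prod_range_five_mul {R : Type*} [CommMonoid R] (f : ℕ → R) (N : ℕ) :
    ∏ i ∈ range (5 * N), f i = ∏ i ∈ range N,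
      (f (5 * i) * f (5 * i + 1) * f (5 * i + 2) * f (5 * i + 3) * f (5 * i + 4)) := by
  induction N with
  | zero => simp
  | succ N ih =>
    rw [Finset.prod_range_succ _ N, ← ih, show 5 * (N + 1) = 5 * N + 1 + 1 + 1 + 1 + 1 by ring]
    simp only [Finset.prod_range_succ, mul_assoc]

theorem reduce_sum_sq_mul_prod (N : ℕ) :
    reduce N (∑ s ∈ range (N + 1), X ^ (s ^ 2) * invPoch 1 s) *
      reduce N (∏ i ∈ range N, ((1 - X ^ (5 * i + 1)) * (1 - X ^ (5 * i + 4)))) = 1 := by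
  have one := isInvPochhammer_invPoch one_pos
  have five := isInvPochhammer_invPoch (m := 5) (by norm_num)
  rw [pow_one] at one
  have h1 := congrArg (reduce N) (sum_sq_eq_alternating_sum one N)
  have h2 := congrArg (reduce N) (alternating_sum_eq_prod five N)
  rw [reduce_alternating_sum one_pos] at h1
  rw [reduce_alternating_sum (by norm_num), map_mul,
    reduce_invPoch (n := N + N) (by norm_num) (by omega)] at h2
  have h3 : reduce N (∑ s ∈ range (N + 1), X ^ (s ^ 2) * (invPoch 1 (N - s) * invPoch 1 s)) =
      reduce N (invPoch 1 N) * reduce N (∑ s ∈ range (N + 1), X ^ (s ^ 2) * invPoch 1 s) := by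
    rw [map_sum, map_sum, Finset.mul_sum]
    refine Finset.sum_congr rfl fun s hs => ?_
    rw [Finset.mem_range] at hs
    have := reduce_X_pow_mul_invPoch one_pos (N := N) (k := s ^ 2) (n := N - s) s
      (by have := Nat.le_self_pow two_ne_zero s; omega)
    rw [Nat.sub_add_cancel (Nat.lt_succ_iff.1 hs), Nat.cast_sub (Nat.lt_succ_iff.1 hs)] at this
    rw [← mul_assoc, map_mul, this]
    simp only [map_mul]
    ring
  rw [h3] at h1
  have unit : ∀ {m : ℕ}, 0 < m → ∀ n : ℕ, IsUnit (reduce N (invPoch m n)) := fun hm n =>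
    (IsUnit.of_mul_eq_one _ (invPoch_mul_prod hm n)).map _
  have h4 := (unit one_pos N).mul_left_cancel h1
  have h5 := (unit (m := 5) (by norm_num) N).mul_left_cancel h2
  have p1 := congrArg (reduce N) (invPoch_mul_prod one_pos (5 * N))
  have p5 := congrArg (reduce N) (invPoch_mul_prod (m := 5) (by norm_num) N)
  rw [map_mul, map_one, reduce_invPoch (n := 5 * N) one_pos (by omega), prod_range_five_mul] at p1
  rw [map_mul, map_one] at p5
  rw [h4]
  simp only [Finset.prod_mul_distrib, map_mul, pow_one, ← pow_mul, add_assoc, mul_add, mul_one,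
    Nat.reduceAdd] at p1 p5 h5 ⊢
  set ρ := reduce N (invPoch 1 N)
  set E := reduce N (∑ j ∈ Icc (-N : ℤ) N, (-1) ^ j.natAbs * X ^ (j * (5 * j - 1) / 2).toNat)
  set B₁ := reduce N (∏ i ∈ range N, (1 - X ^ (5 * i + 1)))
  set B₄ := reduce N (∏ i ∈ range N, (1 - X ^ (5 * i + 4)))
  set B₅ := reduce N (∏ i ∈ range N, (1 - X ^ (5 * i + 5)))
  linear_combination p1 - ρ * B₁ * B₄ * E * p5 + ρ * B₁ * B₄ * B₅ * h5

open scoped PowerSeries.WithPiTopology in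
theorem coeff_sum_sq_eq_card_restricted (n : ℕ) :
    coeff n (∑ s ∈ range (n + 1), X ^ (s ^ 2) * invPoch 1 s) =
      ((Nat.Partition.restricted n (fun x => x % 5 = 1 ∨ x % 5 = 4)).card : ℚ) := by
  let _ : TopologicalSpace ℚ := ⊥
  have _ : DiscreteTopology ℚ := ⟨rfl⟩
  set p : ℕ → Prop := fun x => x % 5 = 1 ∨ x % 5 = 4 with hp
  have hB := Nat.Partition.hasProd_powerSeriesMk_card_restricted ℚ p
  rw [HasProd, SummationFilter.unconditional_filter,
    PowerSeries.WithPiTopology.tendsto_iff_coeff_tendsto] at hB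
  have hB := hB n
  rw [nhds_discrete, Filter.tendsto_pure] at hB
  obtain ⟨M, hM₁, hM₂⟩ := ((Filter.tendsto_finset_range.eventually hB).and
    (Filter.eventually_ge_atTop (5 * n))).exists
  simp only [coeff_mk] at hM₁
  rw [← hM₁]
  refine reduce_eq_iff.1 ?_ n le_rfl
  have h1 := reduce_sum_sq_mul_prod n
  have h2 : (∏ i ∈ range M, if p (i + 1) then ∑' j : ℕ, (X : ℚ⟦X⟧) ^ ((i + 1) * j) else 1) *
      ∏ i ∈ range M, (if p (i + 1) then 1 - X ^ (i + 1) else 1) = 1 := by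
    rw [← Finset.prod_mul_distrib]
    refine Finset.prod_eq_one fun i _ => ?_
    split_ifs
    · simp_rw [pow_mul]
      exact WithPiTopology.tsum_pow_mul_one_sub_of_constantCoeff_eq_zero (by simp)
    · simp
  have h3 : reduce n (∏ i ∈ range M, (if p (i + 1) then 1 - X ^ (i + 1) else 1)) =
      reduce n (∏ i ∈ range n, ((1 - X ^ (5 * i + 1)) * (1 - X ^ (5 * i + 4)))) := by
    obtain ⟨d, rfl⟩ := Nat.exists_eq_add_of_le hM₂
    rw [Finset.prod_range_add, map_mul, prod_range_five_mul,
      map_prod (reduce n) (fun i => if p (5 * n + i + 1) then _ else _),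
      Finset.prod_eq_one (s := range d), mul_one]
    · congr 1
      refine Finset.prod_congr rfl fun i _ => ?_
      simp [hp, Nat.add_mod, add_assoc]
    · intro i _
      split_ifs
      · rw [map_sub, map_one, reduce_X_pow (by omega), sub_zero]
      · simp
  have h4 := congrArg (reduce n) h2
  rw [map_mul, map_one, h3] at h4
  rw [mul_comm] at h1 h4
  exact (IsUnit.of_mul_eq_one _ h1).mul_left_cancel (h1.trans h4.symm)

section Pairs

/-- The set `{i + 1 | i ∈ s}`. -/
def shift (s : Finset ℕ) : Finset ℕ := s.map (addRightEmbedding 1)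

/-- The set `{0} ∪ {i + 1 | i ∈ s}`. -/
def consZero (s : Finset ℕ) : Finset ℕ := insert 0 (shift s)

@[simp] theorem zero_notMem_shift (s : Finset ℕ) : 0 ∉ shift s := by simp [shift]

@[simp] theorem succ_mem_shift {s : Finset ℕ} {i : ℕ} : i + 1 ∈ shift s ↔ i ∈ s := by
  simp [shift]

@[simp] theorem zero_mem_consZero (s : Finset ℕ) : 0 ∈ consZero s := by simp [consZero]

@[simp] theorem succ_mem_consZero {s : Finset ℕ} {i : ℕ} : i + 1 ∈ consZero s ↔ i ∈ s := by
  simp [consZero]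

@[simp] theorem card_shift (s : Finset ℕ) : (shift s).card = s.card := by simp [shift]

@[simp] theorem card_consZero (s : Finset ℕ) : (consZero s).card = s.card + 1 := by
  rw [consZero, Finset.card_insert_of_notMem (by simp), card_shift]

theorem shift_injective : Function.Injective shift := Finset.map_injective _

theorem consZero_injective : Function.Injective consZero := by
  intro s t h
  ext i
  rw [← succ_mem_consZero, h, succ_mem_consZero]

@[simp] theorem shift_inj {s t : Finset ℕ} : shift s = shift t ↔ s = t := shift_injective.eq_iff

@[simp] theorem consZero_inj {s t : Finset ℕ} : consZero s = consZero t ↔ s = t :=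
  consZero_injective.eq_iff

theorem exists_eq_shift_or_consZero (s : Finset ℕ) : ∃ t, s = shift t ∨ s = consZero t := by
  refine ⟨(s.erase 0).image (· - 1), ?_⟩
  have key : ∀ i, i ∈ (s.erase 0).image (· - 1) ↔ i + 1 ∈ s := by
    intro i
    simp only [Finset.mem_image, Finset.mem_erase]
    constructor
    · rintro ⟨a, ⟨h0, ha⟩, rfl⟩
      rwa [Nat.sub_add_cancel (Nat.pos_of_ne_zero h0)]
    · intro h; exact ⟨i + 1, ⟨by simp, h⟩, by simp⟩
  by_cases h : 0 ∈ s
  · right; ext (_ | i)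
    · simp [h]
    · rw [succ_mem_consZero, key]
  · left; ext (_ | i)
    · simp [h]
    · rw [succ_mem_shift, key]

theorem forall_mem_shift {s : Finset ℕ} {P : ℕ → Prop} :
    (∀ i ∈ shift s, P i) ↔ ∀ i ∈ s, P (i + 1) := by
  simp [shift]

theorem forall_mem_consZero {s : Finset ℕ} {P : ℕ → Prop} :
    (∀ i ∈ consZero s, P i) ↔ P 0 ∧ ∀ i ∈ s, P (i + 1) := by
  rw [consZero, Finset.forall_mem_insert, forall_mem_shift]

theorem sum_shift (s : Finset ℕ) (f : ℕ → ℕ) : ∑ i ∈ shift s, f i = ∑ i ∈ s, f (i + 1) := by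
  simp [shift]

theorem sum_consZero (s : Finset ℕ) (f : ℕ → ℕ) :
    ∑ i ∈ consZero s, f i = f 0 + ∑ i ∈ s, f (i + 1) := by
  rw [consZero, Finset.sum_insert (by simp), sum_shift]

/-- The number of elements of `s` below `i`. -/
def rank (s : Finset ℕ) (i : ℕ) : ℕ := (s.filter (· < i)).card

@[simp] theorem rank_zero (s : Finset ℕ) : rank s 0 = 0 := by simp [rank]

@[simp] theorem rank_shift (s : Finset ℕ) (i : ℕ) : rank (shift s) (i + 1) = rank s i := by
  rw [rank, rank, shift, Finset.filter_map, Finset.card_map]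
  congr 1; ext; simp

@[simp] theorem rank_consZero (s : Finset ℕ) (i : ℕ) :
    rank (consZero s) (i + 1) = rank s i + 1 := by
  rw [rank, consZero, Finset.filter_insert, if_pos (by simp),
    Finset.card_insert_of_notMem (by simp), ← rank_shift]; rfl

/-- The pair `(O, E)` encodes the partition whose odd parts are `2 * i + 1` for `i ∈ O` and whose
even parts are `2 * i + 2` for `i ∈ E`; this is the size of that partition. -/
def weight (p : Finset ℕ × Finset ℕ) : ℕ := ∑ i ∈ p.1, (2 * i + 1) + ∑ i ∈ p.2, (2 * i + 2)

theorem finite_weight_eq (n : ℕ) : {p | weight p = n}.Finite := by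
  refine ((range n).powerset ×ˢ (range n).powerset).finite_toSet.subset ?_
  rintro ⟨O, E⟩ h
  simp only [weight, Set.mem_ofPred_eq] at h
  simp only [Finset.coe_product, Set.mem_prod, Finset.mem_coe, Finset.mem_powerset]
  constructor <;> intro i hi <;> rw [Finset.mem_range]
  · have := Finset.single_le_sum (f := fun i => 2 * i + 1) (fun _ _ => Nat.zero_le _) hi
    omega
  · have := Finset.single_le_sum (f := fun i => 2 * i + 2) (fun _ _ => Nat.zero_le _) hi
    omega

theorem finite_sep_weight_eq (T : Set (Finset ℕ × Finset ℕ)) (n : ℕ) :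
    {p ∈ T | weight p = n}.Finite :=
  (finite_weight_eq n).subset fun _ => And.right

/-- The generating function of a set of pairs by weight. -/
noncomputable def gf (T : Set (Finset ℕ × Finset ℕ)) : ℚ⟦X⟧ :=
  PowerSeries.mk fun n => ({p ∈ T | weight p = n}.ncard : ℚ)

theorem gf_empty : gf ∅ = 0 := by ext n; simp [gf]

theorem gf_singleton_empty : gf {(∅, ∅)} = 1 := by
  ext n
  rw [gf, coeff_mk, coeff_one]
  split_ifs with h
  · subst h
    rw [Nat.cast_eq_one, Set.ncard_eq_one]
    refine ⟨(∅, ∅), ?_⟩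
    ext p
    simp only [Set.mem_singleton_iff, Set.mem_ofPred_eq]
    constructor <;> simp +contextual [weight]
  · rw [Nat.cast_eq_zero]
    rw [Set.ncard_eq_zero (finite_sep_weight_eq _ n),
      Set.eq_empty_iff_forall_notMem]
    rintro p ⟨rfl, h'⟩
    exact h (by rw [← h']; simp [weight])

theorem gf_union {S T : Set (Finset ℕ × Finset ℕ)} (h : Disjoint S T) :
    gf (S ∪ T) = gf S + gf T := by
  ext n
  simp only [gf, coeff_mk, map_add]
  have := Set.ncard_union_eq (s := {p ∈ S | weight p = n}) (t := {p ∈ T | weight p = n})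
    (h.mono (fun _ => And.left) (fun _ => And.left))
    (finite_sep_weight_eq S n) (finite_sep_weight_eq T n)
  rw [← Nat.cast_add, ← this]
  congr 2; ext p; simp only [Set.mem_union, Set.mem_ofPred_eq]; tauto

theorem gf_image {T : Set (Finset ℕ × Finset ℕ)} {f : Finset ℕ × Finset ℕ → Finset ℕ × Finset ℕ}
    {d : ℕ} (hf : Set.InjOn f T) (hd : ∀ p ∈ T, weight (f p) = weight p + d) :
    gf (f '' T) = X ^ d * gf T := by
  ext n
  rw [coeff_X_pow_mul']
  simp only [gf, coeff_mk]
  split_ifs with h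
  · rw [← (hf.mono (fun _ => And.left) :
      Set.InjOn f {p ∈ T | weight p = n - d}).ncard_image]
    congr 2; ext p
    simp only [Set.mem_ofPred_eq, Set.mem_image]
    constructor
    · rintro ⟨⟨q, hq, rfl⟩, hn⟩
      exact ⟨q, ⟨hq, by rw [hd q hq] at hn; omega⟩, rfl⟩
    · rintro ⟨q, ⟨hq, hn⟩, rfl⟩
      exact ⟨⟨q, hq, rfl⟩, by rw [hd q hq]; omega⟩
  · rw [Nat.cast_eq_zero]
    rw [Set.ncard_eq_zero (finite_sep_weight_eq _ n),
      Set.eq_empty_iff_forall_notMem]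
    rintro _ ⟨⟨q, hq, rfl⟩, hn⟩
    rw [hd q hq] at hn; omega

/-- Pairs of sets of prescribed sizes satisfying the condition `P`. -/
def sized (P : Finset ℕ × Finset ℕ → Prop) (k l : ℤ) : Set (Finset ℕ × Finset ℕ) :=
  {p | (p.1.card : ℤ) = k ∧ (p.2.card : ℤ) = l ∧ P p}

theorem gf_sized_of_neg {P : Finset ℕ × Finset ℕ → Prop} {k l : ℤ} (h : k < 0 ∨ l < 0) :
    gf (sized P k l) = 0 := by
  convert! gf_empty
  ext p
  simp only [sized, Set.mem_ofPred_eq, Set.mem_empty_iff_false, iff_false]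
  omega

theorem gf_sized_zero {P : Finset ℕ × Finset ℕ → Prop} (h : P (∅, ∅)) :
    gf (sized P 0 0) = 1 := by
  rw [← gf_singleton_empty]
  congr 1
  ext ⟨O, E⟩
  simp only [sized, Set.mem_ofPred_eq, Set.mem_singleton_iff, Prod.mk.injEq, Nat.cast_eq_zero,
    Finset.card_eq_zero]
  constructor
  · rintro ⟨h1, h2, -⟩; exact ⟨h1, h2⟩
  · rintro ⟨rfl, rfl⟩; exact ⟨rfl, rfl, h⟩

/-- No two elements of the encoded partition are consecutive. -/
def CondA (p : Finset ℕ × Finset ℕ) : Prop := ∀ i ∈ p.1, ∀ e ∈ p.2, e ≠ i ∧ e + 1 ≠ i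

/-- The encoded partition avoids the even parts forbidden by its odd parts. -/
def CondC (p : Finset ℕ × Finset ℕ) : Prop :=
  ∀ i ∈ p.1, ∀ e ∈ p.2, e ≠ i + rank p.1 i ∧ e + 1 ≠ i + rank p.1 i

/-- The encoded partition avoids the odd parts forbidden by its even parts. -/
def CondD (p : Finset ℕ × Finset ℕ) : Prop :=
  ∀ i ∈ p.2, ∀ o ∈ p.1, o ≠ i + rank p.2 i ∧ o ≠ i + rank p.2 i + 1

theorem condA_shift_shift (O E : Finset ℕ) : CondA (shift O, shift E) ↔ CondA (O, E) := by
  simp [CondA, forall_mem_shift]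

theorem condA_shift_consZero (O E : Finset ℕ) :
    CondA (shift O, consZero E) ↔ CondA (O, E) ∧ 0 ∉ O := by
  simp only [CondA, forall_mem_shift, forall_mem_consZero]
  grind

theorem condA_consZero_shift (O E : Finset ℕ) : CondA (consZero O, shift E) ↔ CondA (O, E) := by
  simp [CondA, forall_mem_shift, forall_mem_consZero]

theorem not_condA_consZero_consZero (O E : Finset ℕ) : ¬ CondA (consZero O, consZero E) := by
  simp [CondA, forall_mem_consZero]

theorem condC_shift_shift (O E : Finset ℕ) : CondC (shift O, shift E) ↔ CondC (O, E) := by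
  simp only [CondC, forall_mem_shift, rank_shift]
  grind

theorem condC_shift_consZero (O E : Finset ℕ) :
    CondC (shift O, consZero E) ↔ CondC (O, E) ∧ 0 ∉ O := by
  simp only [CondC, forall_mem_shift, forall_mem_consZero, rank_shift]
  have := rank_zero O
  grind

theorem condC_consZero_shift (O E : Finset ℕ) :
    CondC (consZero O, shift E) ↔ CondC (shift O, E) := by
  simp only [CondC, forall_mem_shift, forall_mem_consZero, rank_shift, rank_consZero, rank_zero]
  grind

theorem not_condC_consZero_consZero (O E : Finset ℕ) : ¬ CondC (consZero O, consZero E) := by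
  simp [CondC, forall_mem_consZero]

theorem condD_shift_shift (O E : Finset ℕ) : CondD (shift O, shift E) ↔ CondD (O, E) := by
  simp only [CondD, forall_mem_shift, rank_shift]
  grind

theorem condD_consZero_shift (O E : Finset ℕ) : CondD (consZero O, shift E) ↔ CondD (O, E) := by
  simp only [CondD, forall_mem_shift, forall_mem_consZero, rank_shift]
  grind

theorem condD_shift_shift_consZero (O E : Finset ℕ) :
    CondD (shift (shift O), consZero E) ↔ CondD (O, E) := by
  simp only [CondD, forall_mem_shift, forall_mem_consZero, rank_consZero, rank_zero]
  grind

theorem not_condD_consZero_consZero (O E : Finset ℕ) : ¬ CondD (consZero O, consZero E) := by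
  simp [CondD, forall_mem_consZero]

theorem not_condD_shift_consZero_consZero (O E : Finset ℕ) :
    ¬ CondD (shift (consZero O), consZero E) := by
  simp [CondD, forall_mem_consZero, forall_mem_shift]

theorem insert_zero_shift (s : Finset ℕ) : insert 0 (shift s) = consZero s := rfl

theorem weight_shift_shift (O E : Finset ℕ) :
    weight (shift O, shift E) = weight (O, E) + (2 * O.card + 2 * E.card) := by
  simp only [weight, sum_shift, Finset.card_eq_sum_ones, Finset.mul_sum]
  simp only [mul_add, Finset.sum_add_distrib]; ring

theorem weight_consZero_shift (O E : Finset ℕ) :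
    weight (consZero O, shift E) = weight (O, E) + (1 + 2 * O.card + 2 * E.card) := by
  simp only [weight, sum_shift, sum_consZero, Finset.card_eq_sum_ones, Finset.mul_sum]
  simp only [mul_add, Finset.sum_add_distrib]; ring

theorem weight_shift_consZero (O E : Finset ℕ) :
    weight (shift O, consZero E) = weight (O, E) + (2 + 2 * O.card + 2 * E.card) := by
  simp only [weight, sum_shift, sum_consZero, Finset.card_eq_sum_ones, Finset.mul_sum]
  simp only [mul_add, Finset.sum_add_distrib]; ring

theorem weight_shift_shift_consZero (O E : Finset ℕ) :
    weight (shift (shift O), consZero E) = weight (O, E) + (2 + 4 * O.card + 2 * E.card) := by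
  simp only [weight, sum_shift, sum_consZero, mul_add, Finset.sum_add_distrib, Finset.sum_const,
    smul_eq_mul, card_shift, card_consZero]
  ring

theorem weight_insert_zero_shift {O : Finset ℕ} (h : 0 ∉ O) (E : Finset ℕ) :
    weight (insert 0 O, shift E) = weight (O, E) + (1 + 2 * E.card) := by
  simp only [weight, sum_shift, Finset.sum_insert h, Finset.card_eq_sum_ones, Finset.mul_sum]
  simp only [mul_add, Finset.sum_add_distrib]; ring

theorem shift_ne_consZero (s t : Finset ℕ) : shift s ≠ consZero t := fun h =>
  zero_notMem_shift s (h ▸ zero_mem_consZero t)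

theorem gf_condD_rec (k l : ℤ) :
    gf (sized CondD k l) = X ^ (2 * k + 2 * l).toNat * gf (sized CondD k l) +
      X ^ (2 * k + 2 * l - 1).toNat * gf (sized CondD (k - 1) l) +
      X ^ (4 * k + 2 * l).toNat * gf (sized CondD k (l - 1)) := by
  have h : sized CondD k l =
      ((fun p => (shift p.1, shift p.2)) '' sized CondD k l ∪
        (fun p => (consZero p.1, shift p.2)) '' sized CondD (k - 1) l) ∪
        (fun p => (shift (shift p.1), consZero p.2)) '' sized CondD k (l - 1) := by
    ext ⟨O, E⟩
    constructor
    · rintro ⟨hk, hl, hD⟩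
      dsimp only at hk hl
      obtain ⟨E, rfl | rfl⟩ := exists_eq_shift_or_consZero E <;>
      obtain ⟨O, rfl | rfl⟩ := exists_eq_shift_or_consZero O
      · exact .inl (.inl ⟨(O, E), ⟨by simpa using hk, by simpa using hl,
          (condD_shift_shift O E).1 hD⟩, rfl⟩)
      · exact .inl (.inr ⟨(O, E), ⟨by simp at hk ⊢; omega, by simpa using hl,
          (condD_consZero_shift O E).1 hD⟩, rfl⟩)
      · obtain ⟨O, rfl | rfl⟩ := exists_eq_shift_or_consZero O
        · exact .inr ⟨(O, E), ⟨by simpa using hk, by simp at hl ⊢; omega,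
            (condD_shift_shift_consZero O E).1 hD⟩, rfl⟩
        · exact (not_condD_shift_consZero_consZero O E hD).elim
      · exact (not_condD_consZero_consZero O E hD).elim
    · rintro ((⟨⟨O', E'⟩, ⟨hk, hl, hD⟩, h⟩ | ⟨⟨O', E'⟩, ⟨hk, hl, hD⟩, h⟩) |
        ⟨⟨O', E'⟩, ⟨hk, hl, hD⟩, h⟩) <;> obtain ⟨rfl, rfl⟩ := Prod.mk.inj h <;>
        refine ⟨?_, ?_, ?_⟩ <;> dsimp only at hk hl ⊢
      all_goals first
        | exact (condD_shift_shift _ _).2 hD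
        | exact (condD_consZero_shift _ _).2 hD
        | exact (condD_shift_shift_consZero _ _).2 hD
        | (simp only [card_shift, card_consZero]; push_cast; omega)
  conv_lhs => rw [h]
  rw [gf_union, gf_union, gf_image (d := (2 * k + 2 * l).toNat),
    gf_image (d := (2 * k + 2 * l - 1).toNat), gf_image (d := (4 * k + 2 * l).toNat)]
  · rintro ⟨O, E⟩ - ⟨O', E'⟩ - h; simpa using h
  · rintro ⟨O, E⟩ ⟨hk, hl, -⟩
    dsimp only at hk hl ⊢
    rw [weight_shift_shift_consZero]; omega
  · rintro ⟨O, E⟩ - ⟨O', E'⟩ - h; simpa using h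
  · rintro ⟨O, E⟩ ⟨hk, hl, -⟩
    dsimp only at hk hl ⊢
    rw [weight_consZero_shift]; omega
  · rintro ⟨O, E⟩ - ⟨O', E'⟩ - h; simpa using h
  · rintro ⟨O, E⟩ ⟨hk, hl, -⟩
    dsimp only at hk hl ⊢
    rw [weight_shift_shift]; omega
  · rw [Set.disjoint_left]
    rintro _ ⟨p, -, rfl⟩ ⟨q, -, h⟩
    exact shift_ne_consZero _ _ (Prod.mk.inj h).1.symm
  · rw [Set.disjoint_left]
    rintro _ (⟨p, -, rfl⟩ | ⟨p, -, rfl⟩) ⟨q, -, h⟩ <;>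
      exact shift_ne_consZero _ _ (Prod.mk.inj h).2.symm

/-- The pairs satisfying `P` that encode partitions without the part `1`. -/
def WithoutOne (P : Finset ℕ × Finset ℕ → Prop) (p : Finset ℕ × Finset ℕ) : Prop :=
  P p ∧ 0 ∉ p.1

theorem gf_withoutOne_rec {P : Finset ℕ × Finset ℕ → Prop}
    (h₁ : ∀ O E, P (shift O, shift E) ↔ P (O, E))
    (h₂ : ∀ O E, P (shift O, consZero E) ↔ P (O, E) ∧ 0 ∉ O) (k l : ℤ) :
    gf (sized (WithoutOne P) k l) = X ^ (2 * k + 2 * l).toNat * gf (sized P k l) +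
      X ^ (2 * k + 2 * l).toNat * gf (sized (WithoutOne P) k (l - 1)) := by
  have h : sized (WithoutOne P) k l =
      (fun p => (shift p.1, shift p.2)) '' sized P k l ∪
        (fun p => (shift p.1, consZero p.2)) '' sized (WithoutOne P) k (l - 1) := by
    ext ⟨O, E⟩
    constructor
    · rintro ⟨hk, hl, hP, hO⟩
      dsimp only at hk hl
      obtain ⟨O, rfl | rfl⟩ := exists_eq_shift_or_consZero O
      · obtain ⟨E, rfl | rfl⟩ := exists_eq_shift_or_consZero E
        · exact .inl ⟨(O, E), ⟨by simpa using hk, by simpa using hl, (h₁ O E).1 hP⟩, rfl⟩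
        · exact .inr ⟨(O, E), ⟨by simpa using hk, by simp at hl ⊢; omega, (h₂ O E).1 hP⟩, rfl⟩
      · simp at hO
    · rintro (⟨⟨O', E'⟩, ⟨hk, hl, hD⟩, h⟩ | ⟨⟨O', E'⟩, ⟨hk, hl, hD⟩, h⟩) <;>
        obtain ⟨rfl, rfl⟩ := Prod.mk.inj h <;> refine ⟨?_, ?_, ?_, zero_notMem_shift _⟩ <;>
        dsimp only at hk hl ⊢
      all_goals first
        | exact (h₁ _ _).2 hD
        | exact (h₂ _ _).2 hD
        | (simp only [card_shift, card_consZero]; push_cast; omega)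
  rw [h, gf_union, gf_image (d := (2 * k + 2 * l).toNat), gf_image (d := (2 * k + 2 * l).toNat)]
  · rintro ⟨O, E⟩ - ⟨O', E'⟩ - h; simpa using h
  · rintro ⟨O, E⟩ ⟨hk, hl, -⟩
    dsimp only at hk hl ⊢
    rw [weight_shift_consZero]; omega
  · rintro ⟨O, E⟩ - ⟨O', E'⟩ - h; simpa using h
  · rintro ⟨O, E⟩ ⟨hk, hl, -⟩
    dsimp only at hk hl ⊢
    rw [weight_shift_shift]; omega
  · rw [Set.disjoint_left]
    rintro _ ⟨p, -, rfl⟩ ⟨q, -, h⟩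
    exact shift_ne_consZero _ _ (Prod.mk.inj h).2.symm

theorem gf_condA_rec (k l : ℤ) :
    gf (sized CondA k l) = gf (sized (WithoutOne CondA) k l) +
      X ^ (2 * k + 2 * l - 1).toNat * gf (sized CondA (k - 1) l) := by
  have h : sized CondA k l = sized (WithoutOne CondA) k l ∪
      (fun p => (consZero p.1, shift p.2)) '' sized CondA (k - 1) l := by
    ext ⟨O, E⟩
    constructor
    · rintro ⟨hk, hl, hP⟩
      dsimp only at hk hl
      obtain ⟨O, rfl | rfl⟩ := exists_eq_shift_or_consZero O
      · exact .inl ⟨hk, hl, hP, zero_notMem_shift _⟩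
      · obtain ⟨E, rfl | rfl⟩ := exists_eq_shift_or_consZero E
        · exact .inr ⟨(O, E), ⟨by simp at hk ⊢; omega, by simpa using hl,
            (condA_consZero_shift O E).1 hP⟩, rfl⟩
        · exact (not_condA_consZero_consZero O E hP).elim
    · rintro (⟨hk, hl, hP, -⟩ | ⟨⟨O', E'⟩, ⟨hk, hl, hP⟩, h⟩)
      · exact ⟨hk, hl, hP⟩
      · obtain ⟨rfl, rfl⟩ := Prod.mk.inj h
        dsimp only at hk hl
        exact ⟨by simp; omega, by simpa using hl, (condA_consZero_shift _ _).2 hP⟩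
  rw [h, gf_union, gf_image (d := (2 * k + 2 * l - 1).toNat)]
  · rintro ⟨O, E⟩ - ⟨O', E'⟩ - h; simpa using h
  · rintro ⟨O, E⟩ ⟨hk, hl, -⟩
    dsimp only at hk hl ⊢
    rw [weight_consZero_shift]; omega
  · rw [Set.disjoint_left]
    rintro _ ⟨-, -, -, h⟩ ⟨q, -, rfl⟩
    exact h (zero_mem_consZero _)

theorem gf_condC_rec (k l : ℤ) :
    gf (sized CondC k l) = gf (sized (WithoutOne CondC) k l) +
      X ^ (2 * l + 1).toNat * gf (sized (WithoutOne CondC) (k - 1) l) := by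
  have h : sized CondC k l = sized (WithoutOne CondC) k l ∪
      (fun p => (insert 0 p.1, shift p.2)) '' sized (WithoutOne CondC) (k - 1) l := by
    ext ⟨O, E⟩
    constructor
    · rintro ⟨hk, hl, hP⟩
      dsimp only at hk hl
      obtain ⟨O, rfl | rfl⟩ := exists_eq_shift_or_consZero O
      · exact .inl ⟨hk, hl, hP, zero_notMem_shift _⟩
      · obtain ⟨E, rfl | rfl⟩ := exists_eq_shift_or_consZero E
        · exact .inr ⟨(shift O, E), ⟨by simp at hk ⊢; omega, by simpa using hl,
            (condC_consZero_shift O E).1 hP, zero_notMem_shift _⟩, rfl⟩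
        · exact (not_condC_consZero_consZero O E hP).elim
    · rintro (⟨hk, hl, hP, -⟩ | ⟨⟨O', E'⟩, ⟨hk, hl, hP, h0⟩, h⟩)
      · exact ⟨hk, hl, hP⟩
      · obtain ⟨rfl, rfl⟩ := Prod.mk.inj h
        obtain ⟨O', rfl | rfl⟩ := exists_eq_shift_or_consZero O'
        · dsimp only at hk hl
          refine ⟨?_, by simpa using hl, (condC_consZero_shift _ _).2 hP⟩
          rw [card_shift] at hk
          rw [insert_zero_shift, card_consZero]; push_cast; omega
        · simp at h0
  rw [h, gf_union, gf_image (d := (2 * l + 1).toNat)]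
  · rintro ⟨O, E⟩ ⟨-, -, -, h0⟩ ⟨O', E'⟩ ⟨-, -, -, h0'⟩ h
    obtain ⟨h1, h2⟩ := Prod.mk.inj h
    dsimp only at h0 h0' h1
    refine Prod.ext ?_ (shift_inj.1 h2)
    dsimp only
    rw [← Finset.erase_insert h0, h1, Finset.erase_insert h0']
  · rintro ⟨O, E⟩ ⟨hk, hl, -, h0⟩
    dsimp only at hk hl h0 ⊢
    rw [weight_insert_zero_shift h0]; omega
  · rw [Set.disjoint_left]
    rintro _ ⟨-, -, -, h⟩ ⟨q, -, rfl⟩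
    exact h (Finset.mem_insert_self _ _)

end Pairs

section ClosedForm

/-- The common generating function of the pairs of sizes `(k, l)` for each of the conditions. -/
noncomputable def closedForm (k l : ℤ) : ℚ⟦X⟧ :=
  X ^ ((k + l) ^ 2 + l).toNat * (invPoch 2 k * invPoch 2 l)

theorem closedForm_of_neg {k l : ℤ} (h : k < 0 ∨ l < 0) : closedForm k l = 0 := by
  have hq := isInvPochhammer_invPoch (m := 2) (by norm_num)
  rcases h with h | h <;> simp [closedForm, hq.neg _ h]

theorem closedForm_zero_zero : closedForm 0 0 = 1 := by
  have hq := isInvPochhammer_invPoch (m := 2) (by norm_num)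
  simp [closedForm, hq.zero]

theorem closedForm_step_left {k l : ℤ} (hk : 0 ≤ k) (hl : 0 ≤ l) :
    (1 - X ^ (2 * k).toNat) * closedForm k l =
      X ^ (2 * k + 2 * l - 1).toNat * closedForm (k - 1) l := by
  have hq := isInvPochhammer_invPoch (m := 2) (by norm_num)
  rcases hk.eq_or_lt with rfl | hk
  · simp [closedForm_of_neg (k := -1)]
  have h1 := hq.step k
  rw [← pow_mul, show 2 * k.toNat = (2 * k).toNat by omega] at h1
  rw [closedForm, closedForm, ← h1]
  have : ((k + l) ^ 2 + l).toNat = (2 * k + 2 * l - 1).toNat + ((k - 1 + l) ^ 2 + l).toNat := by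
    have : 0 ≤ (k - 1 + l) ^ 2 := sq_nonneg _
    rw [← Int.toNat_add (by omega) (by omega)]
    congr 1; ring
  rw [this, pow_add]; ring

theorem closedForm_step_right {k l : ℤ} (hk : 0 ≤ k) (hl : 0 ≤ l) :
    (1 - X ^ (2 * l).toNat) * closedForm k l =
      X ^ (2 * k + 2 * l).toNat * closedForm k (l - 1) := by
  have hq := isInvPochhammer_invPoch (m := 2) (by norm_num)
  rcases hl.eq_or_lt with rfl | hl
  · simp [closedForm_of_neg (l := -1)]
  have h1 := hq.step l
  rw [← pow_mul, show 2 * l.toNat = (2 * l).toNat by omega] at h1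
  rw [closedForm, closedForm, ← h1]
  have : ((k + l) ^ 2 + l).toNat =
      (2 * k + 2 * l).toNat + ((k + (l - 1)) ^ 2 + (l - 1)).toNat := by
    have : 0 ≤ (k + (l - 1)) ^ 2 := sq_nonneg _
    rw [← Int.toNat_add (by omega) (by omega)]
    congr 1; ring
  rw [this, pow_add]; ring

theorem one_sub_X_pow_ne_zero {n : ℕ} (hn : 0 < n) : (1 - X ^ n : ℚ⟦X⟧) ≠ 0 := by
  intro h
  simpa [hn.ne'] using congrArg (constantCoeff (R := ℚ)) h

theorem X_pow_toNat_add {a b : ℤ} (ha : 0 ≤ a) (hb : 0 ≤ b) :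
    (X ^ (a + b).toNat : ℚ⟦X⟧) = X ^ a.toNat * X ^ b.toNat := by
  rw [Int.toNat_add ha hb, pow_add]

theorem condD_empty : CondD (∅, ∅) := by simp [CondD]

theorem gf_condD (k l : ℤ) : gf (sized CondD k l) = closedForm k l := by
  by_cases hkl : k < 0 ∨ l < 0
  · rw [gf_sized_of_neg hkl, closedForm_of_neg hkl]
  obtain ⟨s, hs⟩ : ∃ s : ℕ, k + l = s := ⟨(k + l).toNat, by omega⟩
  induction s generalizing k l with
  | zero =>
    obtain ⟨rfl, rfl⟩ : k = 0 ∧ l = 0 := by omega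
    rw [gf_sized_zero condD_empty, closedForm_zero_zero]
  | succ s ih =>
    have ih' : ∀ k' l' : ℤ, k' + l' = s → gf (sized CondD k' l') = closedForm k' l' := by
      intro k' l' hs'
      by_cases hkl' : k' < 0 ∨ l' < 0
      · rw [gf_sized_of_neg hkl', closedForm_of_neg hkl']
      · exact ih k' l' hkl' hs'
    have h := gf_condD_rec k l
    rw [ih' (k - 1) l (by omega), ih' k (l - 1) (by omega),
      show 4 * k + 2 * l = 2 * k + (2 * k + 2 * l) by ring,
      X_pow_toNat_add (a := 2 * k) (b := 2 * k + 2 * l) (by omega) (by omega)] at h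
    have h1 := closedForm_step_left (k := k) (l := l) (by omega) (by omega)
    have h2 := closedForm_step_right (k := k) (l := l) (by omega) (by omega)
    have h3 := X_pow_toNat_add (a := 2 * k) (b := 2 * l) (by omega) (by omega)
    refine mul_left_cancel₀ (one_sub_X_pow_ne_zero (n := (2 * k + 2 * l).toNat) (by omega)) ?_
    linear_combination h - h1 - X ^ (2 * k).toNat * h2 + closedForm k l * h3

/-- A system of recurrences for a family `F` with an auxiliary family `W` that determines both. -/
theorem eq_closedForm_of_rec {F W : ℤ → ℤ → ℚ⟦X⟧} (hF₀ : ∀ k l, k < 0 ∨ l < 0 → F k l = 0)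
    (hW₀ : ∀ k l, k < 0 ∨ l < 0 → W k l = 0) (h₀ : F 0 0 = 1)
    (hW : ∀ k l, W k l = X ^ (2 * k + 2 * l).toNat * F k l +
      X ^ (2 * k + 2 * l).toNat * W k (l - 1))
    (hF : ∀ k l, 0 ≤ k → 0 ≤ l → F (k - 1) l = closedForm (k - 1) l →
      W (k - 1) l = X ^ (2 * (k - 1)).toNat * closedForm (k - 1) l →
      F k l = W k l + X ^ (2 * k + 2 * l - 1).toNat * closedForm (k - 1) l) (k l : ℤ) :
    F k l = closedForm k l ∧ W k l = X ^ (2 * k).toNat * closedForm k l := by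
  by_cases hkl : k < 0 ∨ l < 0
  · simp [hF₀ _ _ hkl, hW₀ _ _ hkl, closedForm_of_neg hkl]
  obtain ⟨s, hs⟩ : ∃ s : ℕ, k + l = s := ⟨(k + l).toNat, by omega⟩
  induction s generalizing k l with
  | zero =>
    obtain ⟨rfl, rfl⟩ : k = 0 ∧ l = 0 := by omega
    have h := hW 0 0
    rw [hW₀ 0 (0 - 1) (by norm_num), h₀] at h
    rw [h₀, h]
    simp [closedForm_zero_zero]
  | succ s ih =>
    have ih' : ∀ k' l' : ℤ, k' + l' = s →
        F k' l' = closedForm k' l' ∧ W k' l' = X ^ (2 * k').toNat * closedForm k' l' := by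
      intro k' l' hs'
      by_cases hkl' : k' < 0 ∨ l' < 0
      · simp [hF₀ _ _ hkl', hW₀ _ _ hkl', closedForm_of_neg hkl']
      · exact ih k' l' hkl' hs'
    obtain ⟨hF', hW'⟩ := ih' (k - 1) l (by omega)
    have e1 := hF k l (by omega) (by omega) hF' hW'
    have e2 := hW k l
    rw [(ih' k (l - 1) (by omega)).2] at e2
    have h1 := closedForm_step_left (k := k) (l := l) (by omega) (by omega)
    have h2 := closedForm_step_right (k := k) (l := l) (by omega) (by omega)
    have h3 := X_pow_toNat_add (a := 2 * k) (b := 2 * l) (by omega) (by omega)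
    have key : F k l = closedForm k l := by
      refine mul_left_cancel₀ (one_sub_X_pow_ne_zero (n := (2 * k + 2 * l).toNat) (by omega)) ?_
      linear_combination e1 + e2 - h1 - X ^ (2 * k).toNat * h2 + closedForm k l * h3
    exact ⟨key, by linear_combination key - e1 + h1⟩

theorem gf_condA (k l : ℤ) : gf (sized CondA k l) = closedForm k l := by
  refine (eq_closedForm_of_rec (F := fun k l => gf (sized CondA k l))
    (W := fun k l => gf (sized (WithoutOne CondA) k l)) (fun _ _ => gf_sized_of_neg)
    (fun _ _ => gf_sized_of_neg) (gf_sized_zero (by simp [CondA]))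
    (gf_withoutOne_rec condA_shift_shift condA_shift_consZero) ?_ k l).1
  intro k l _ _ h _
  rw [← h]
  exact gf_condA_rec k l

theorem gf_condC (k l : ℤ) : gf (sized CondC k l) = closedForm k l := by
  refine (eq_closedForm_of_rec (F := fun k l => gf (sized CondC k l))
    (W := fun k l => gf (sized (WithoutOne CondC) k l)) (fun _ _ => gf_sized_of_neg)
    (fun _ _ => gf_sized_of_neg) (gf_sized_zero (by simp [CondC]))
    (gf_withoutOne_rec condC_shift_shift condC_shift_consZero) ?_ k l).1
  intro k l hk hl _ h
  have := gf_condC_rec k l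
  rw [this, h]
  rcases hk.eq_or_lt with rfl | hk
  · simp [closedForm_of_neg (k := -1)]
  · rw [← mul_assoc, ← X_pow_toNat_add (by omega) (by omega)]
    congr 4; ring

theorem sum_antidiagonal_closedForm (s : ℕ) :
    ∑ p ∈ antidiagonal s, closedForm p.1 p.2 = X ^ (s ^ 2) * invPoch 1 s := by
  induction s with
  | zero =>
    have hq := isInvPochhammer_invPoch (m := 1) (by norm_num)
    simp [closedForm_zero_zero, hq.zero]
  | succ s ih =>
    have hq := isInvPochhammer_invPoch (m := 1) (by norm_num)
    refine mul_left_cancel₀ (one_sub_X_pow_ne_zero (n := s + 1) (by omega)) ?_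
    have h1 := hq.step_of_eq (n := (s + 1 : ℕ)) rfl
    rw [pow_one, show ((s + 1 : ℕ) : ℤ) - 1 = s by push_cast; ring] at h1
    have h2 : ∑ p ∈ antidiagonal (s + 1), X ^ (2 * p.1) * closedForm p.1 p.2 =
        X ^ (s + 1) * ∑ p ∈ antidiagonal (s + 1), closedForm p.1 p.2 := by
      rw [← Finset.Nat.sum_antidiagonal_swap (f := fun p : ℕ × ℕ => closedForm p.1 p.2),
        Finset.mul_sum]
      refine Finset.sum_congr rfl fun p hp => ?_
      rw [HasAntidiagonal.mem_antidiagonal] at hp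
      have e : ((p.1 + p.2 : ℤ) ^ 2 + p.2).toNat = (p.1 + p.2) ^ 2 + p.2 := by
        zify; rw [Int.toNat_of_nonneg (by positivity)]
      have e' : ((p.2 + p.1 : ℤ) ^ 2 + p.1).toNat = (p.2 + p.1) ^ 2 + p.1 := by
        zify; rw [Int.toNat_of_nonneg (by positivity)]
      simp only [closedForm, Prod.fst_swap, Prod.snd_swap]
      rw [e, e', ← hp]
      ring
    have h3 : ∑ p ∈ antidiagonal (s + 1), (1 - X ^ (2 * p.1)) * closedForm p.1 p.2 =
        X ^ (2 * s + 1) * ∑ p ∈ antidiagonal s, closedForm p.1 p.2 := by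
      rw [Finset.Nat.antidiagonal_succ, Finset.sum_cons, Finset.sum_map, Finset.mul_sum]
      simp only [mul_zero, pow_zero, sub_self, zero_mul, zero_add]
      refine Finset.sum_congr rfl fun p hp => ?_
      rw [HasAntidiagonal.mem_antidiagonal] at hp
      have := closedForm_step_left (k := (p.1 + 1 : ℕ)) (l := p.2) (by omega) (by omega)
      rw [show (2 * ((p.1 + 1 : ℕ) : ℤ)).toNat = 2 * (p.1 + 1) by omega,
        show (2 * ((p.1 + 1 : ℕ) : ℤ) + 2 * p.2 - 1).toNat = 2 * s + 1 by omega,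
        show ((p.1 + 1 : ℕ) : ℤ) - 1 = p.1 by push_cast; ring] at this
      simpa using this
    simp only [sub_mul, one_mul, Finset.sum_sub_distrib] at h3
    rw [h2, ih] at h3
    have h4 : (X : ℚ⟦X⟧) ^ ((s + 1) ^ 2) = X ^ (2 * s + 1) * X ^ (s ^ 2) := by
      rw [← pow_add]; congr 1; ring
    linear_combination h3 - X ^ ((s + 1) ^ 2) * h1 - invPoch 1 s * h4

end ClosedForm

section Counting

theorem card_add_card_le_weight (p : Finset ℕ × Finset ℕ) : p.1.card + p.2.card ≤ weight p := by
  rw [weight, Finset.card_eq_sum_ones, Finset.card_eq_sum_ones]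
  exact add_le_add (Finset.sum_le_sum fun _ _ => by omega) (Finset.sum_le_sum fun _ _ => by omega)

theorem ncard_weight_eq {P : Finset ℕ × Finset ℕ → Prop}
    (hP : ∀ k l, gf (sized P k l) = closedForm k l) (n : ℕ) :
    ({p | P p ∧ weight p = n}.ncard : ℚ) =
      coeff n (∑ s ∈ range (n + 1), X ^ (s ^ 2) * invPoch 1 s) := by
  have hfin := finite_sep_weight_eq {p | P p} n
  have hmaps : Set.MapsTo (fun p : Finset ℕ × Finset ℕ =>
      (⟨p.1.card + p.2.card, (p.1.card, p.2.card)⟩ : Σ _ : ℕ, ℕ × ℕ)) hfin.toFinset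
      ((range (n + 1)).sigma fun s => antidiagonal s) := by
    intro p hp
    have h : weight p = n := (hfin.mem_toFinset.1 hp).2
    have := card_add_card_le_weight p
    simp only [Finset.coe_sigma, Set.mem_sigma_iff, Finset.mem_coe, Finset.mem_range,
      HasAntidiagonal.mem_antidiagonal, and_true]
    omega
  have h1 : {p | P p ∧ weight p = n}.ncard = hfin.toFinset.card :=
    Set.ncard_eq_toFinset_card _ hfin
  rw [h1, Finset.card_eq_sum_card_fiberwise hmaps, Finset.sum_sigma, map_sum, Nat.cast_sum]
  refine Finset.sum_congr rfl fun s _ => ?_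
  rw [← sum_antidiagonal_closedForm, map_sum, Nat.cast_sum]
  refine Finset.sum_congr rfl fun kl hkl => ?_
  rw [← hP, gf, coeff_mk, ← Set.ncard_coe_finset]
  congr 2
  ext p
  rw [HasAntidiagonal.mem_antidiagonal] at hkl
  simp only [Finset.coe_filter, Set.Finite.mem_toFinset, Set.mem_ofPred_eq, sized, Sigma.mk.injEq,
    heq_eq_eq, Nat.cast_inj, Prod.ext_iff]
  grind

/-- The parts of the partition encoded by a pair. -/
def toParts (p : Finset ℕ × Finset ℕ) : Multiset ℕ :=
  p.1.val.map (fun i => 2 * i + 1) + p.2.val.map (fun i => 2 * i + 2)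

theorem mem_toParts {p : Finset ℕ × Finset ℕ} {x : ℕ} :
    x ∈ toParts p ↔ (∃ i ∈ p.1, 2 * i + 1 = x) ∨ ∃ i ∈ p.2, 2 * i + 2 = x := by
  simp [toParts]

theorem odd_mem_toParts {p : Finset ℕ × Finset ℕ} {i : ℕ} : 2 * i + 1 ∈ toParts p ↔ i ∈ p.1 := by
  rw [mem_toParts]
  constructor
  · rintro (⟨j, hj, h⟩ | ⟨j, -, h⟩)
    · rwa [← show j = i by omega]
    · omega
  · exact fun h => .inl ⟨i, h, rfl⟩

theorem even_mem_toParts {p : Finset ℕ × Finset ℕ} {i : ℕ} :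
    2 * i + 2 ∈ toParts p ↔ i ∈ p.2 := by
  rw [mem_toParts]
  constructor
  · rintro (⟨j, -, h⟩ | ⟨j, hj, h⟩)
    · omega
    · rwa [← show j = i by omega]
  · exact fun h => .inr ⟨i, h, rfl⟩

theorem nodup_toParts (p : Finset ℕ × Finset ℕ) : (toParts p).Nodup := by
  refine Multiset.nodup_add.2 ⟨p.1.nodup.map fun a b h => ?_, p.2.nodup.map fun a b h => ?_, ?_⟩
  · omega
  · omega
  · rw [Multiset.disjoint_left]
    intro x hx hx'
    rw [Multiset.mem_map] at hx hx'
    obtain ⟨i, -, rfl⟩ := hx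
    obtain ⟨j, -, h⟩ := hx'
    omega

theorem sum_toParts (p : Finset ℕ × Finset ℕ) : (toParts p).sum = weight p := by
  rw [toParts, Multiset.sum_add]; rfl

theorem pos_of_mem_toParts {p : Finset ℕ × Finset ℕ} {x : ℕ} (h : x ∈ toParts p) : 0 < x := by
  rcases mem_toParts.1 h with ⟨i, -, rfl⟩ | ⟨i, -, rfl⟩ <;> omega

theorem toParts_injective : Function.Injective toParts := by
  intro p q h
  refine Prod.ext ?_ ?_ <;> ext i
  · rw [← odd_mem_toParts, h, odd_mem_toParts]
  · rw [← even_mem_toParts, h, even_mem_toParts]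

theorem exists_toParts_eq {m : Multiset ℕ} (hm : m.Nodup) (h0 : ∀ x ∈ m, 0 < x) :
    ∃ p, toParts p = m := by
  refine ⟨((range (m.sum + 1)).filter (fun i => 2 * i + 1 ∈ m),
    (range (m.sum + 1)).filter (fun i => 2 * i + 2 ∈ m)), ?_⟩
  refine ((nodup_toParts _).ext hm).2 fun x => ?_
  simp only [mem_toParts, Finset.mem_filter, Finset.mem_range]
  constructor
  · rintro (⟨i, ⟨-, h⟩, rfl⟩ | ⟨i, ⟨-, h⟩, rfl⟩) <;> exact h
  · intro h
    have h1 := h0 x h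
    have h2 := Multiset.le_sum_of_mem h
    rcases Nat.even_or_odd' x with ⟨i, rfl | rfl⟩
    · obtain ⟨j, rfl⟩ : ∃ j, i = j + 1 := ⟨i - 1, by omega⟩
      exact .inr ⟨j, ⟨by omega, h⟩, by ring⟩
    · exact .inl ⟨i, ⟨by omega, h⟩, rfl⟩

theorem card_partition_eq_ncard {Pm : Multiset ℕ → Prop} {Q : Finset ℕ × Finset ℕ → Prop}
    (h : ∀ p, Pm (toParts p) ↔ Q p) (n : ℕ) :
    Nat.card {p : Nat.Partition n // p.parts.Nodup ∧ Pm p.parts} =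
      {p | Q p ∧ weight p = n}.ncard := by
  rw [← Nat.card_coe_set_eq]
  symm
  refine Nat.card_eq_of_bijective (fun p => ⟨⟨toParts p.1, pos_of_mem_toParts,
    (sum_toParts _).trans p.2.2⟩, nodup_toParts _, (h _).2 p.2.1⟩) ⟨fun p q hpq => ?_, ?_⟩
  · exact Subtype.ext (toParts_injective (congrArg (fun r => r.1.parts) hpq))
  · rintro ⟨⟨m, hpos, hsum⟩, hm, hP⟩
    obtain ⟨p, rfl⟩ := exists_toParts_eq hm fun x => hpos
    exact ⟨⟨p, (h p).1 hP, (sum_toParts p).symm.trans hsum⟩, rfl⟩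

theorem card_partition_eq_card_restricted {Pm : Multiset ℕ → Prop}
    {Q : Finset ℕ × Finset ℕ → Prop} (h : ∀ p, Pm (toParts p) ↔ Q p)
    (hQ : ∀ k l, gf (sized Q k l) = closedForm k l) (n : ℕ) :
    Nat.card {p : Nat.Partition n // p.parts.Nodup ∧ Pm p.parts} =
      Nat.card {p : Nat.Partition n // ∀ x ∈ p.parts, x % 5 = 1 ∨ x % 5 = 4} := by
  have h1 := (ncard_weight_eq hQ n).trans (coeff_sum_sq_eq_card_restricted n)
  rw [card_partition_eq_ncard h, Nat.cast_inj.1 h1, Nat.card_eq_fintype_card, Fintype.card_subtype]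
  rfl

theorem forall_mem_toParts {p : Finset ℕ × Finset ℕ} {P : ℕ → Prop} :
    (∀ x ∈ toParts p, P x) ↔ (∀ i ∈ p.1, P (2 * i + 1)) ∧ ∀ i ∈ p.2, P (2 * i + 2) := by
  simp only [mem_toParts]
  grind

theorem gap_iff_condA (p : Finset ℕ × Finset ℕ) :
    (∀ x ∈ toParts p, ∀ y ∈ toParts p, x < y → x + 2 ≤ y) ↔ CondA p := by
  simp only [forall_mem_toParts, CondA]
  constructor
  · rintro ⟨h1, h2⟩ i hi e he
    have := (h1 i hi).2 e he
    have := (h2 e he).1 i hi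
    omega
  · intro h
    refine ⟨fun i hi => ⟨fun j hj => ?_, fun e he => ?_⟩, fun e he => ⟨fun i hi => ?_,
      fun j hj => ?_⟩⟩
    · omega
    · have := h i hi e he; omega
    · have := h i hi e he; omega
    · omega

theorem card_filter_le_eq_rank {s : Finset ℕ} {i : ℕ} (hi : i ∈ s) :
    (s.filter (· ≤ i)).card = rank s i + 1 := by
  rw [rank, ← Finset.card_insert_of_notMem (a := i) (by simp)]
  congr 1
  ext j
  simp only [Finset.mem_filter, Finset.mem_insert]
  grind

theorem card_filter_odd {p : Finset ℕ × Finset ℕ} {i : ℕ} (hi : i ∈ p.1) :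
    ((toParts p).filter (fun y => Odd y ∧ y ≤ 2 * i + 1)).card = rank p.1 i + 1 := by
  rw [← card_filter_le_eq_rank hi, toParts, Multiset.filter_add, Multiset.filter_map,
    Multiset.filter_map, Multiset.card_add, Multiset.card_map, Multiset.card_map, add_comm,
    Multiset.filter_eq_nil.2, Multiset.card_zero, zero_add, Finset.card_def, Finset.filter_val]
  · congr 1
    refine Multiset.filter_congr fun j _ => ?_
    simp
  · rintro j - ⟨h, -⟩
    exact (Nat.not_odd_iff_even.2 ⟨j + 1, by ring⟩) h

theorem card_filter_even {p : Finset ℕ × Finset ℕ} {i : ℕ} (hi : i ∈ p.2) :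
    ((toParts p).filter (fun y => Even y ∧ y ≤ 2 * i + 2)).card = rank p.2 i + 1 := by
  rw [← card_filter_le_eq_rank hi, toParts, Multiset.filter_add, Multiset.filter_map,
    Multiset.filter_map, Multiset.card_add, Multiset.card_map, Multiset.card_map,
    Multiset.filter_eq_nil.2, Multiset.card_zero, zero_add, Finset.card_def, Finset.filter_val]
  · congr 1
    refine Multiset.filter_congr fun j _ => ?_
    simp [Nat.even_add]
  · rintro j - ⟨h, -⟩
    exact (Nat.not_even_iff_odd.2 ⟨j, rfl⟩) h

theorem forbidden_even_iff_condC (p : Finset ℕ × Finset ℕ) :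
    (∀ x ∈ toParts p, Odd x →
      x + 2 * ((toParts p).filter (fun y => Odd y ∧ y ≤ x)).card - 3 ∉ toParts p ∧
      x + 2 * ((toParts p).filter (fun y => Odd y ∧ y ≤ x)).card - 1 ∉ toParts p) ↔ CondC p := by
  rw [forall_mem_toParts, CondC]
  have h0 : (∀ i ∈ p.2, Odd (2 * i + 2) →
      2 * i + 2 + 2 * ((toParts p).filter (fun y => Odd y ∧ y ≤ 2 * i + 2)).card - 3 ∉ toParts p ∧
      2 * i + 2 + 2 * ((toParts p).filter (fun y => Odd y ∧ y ≤ 2 * i + 2)).card - 1 ∉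
        toParts p) :=
    fun i _ h => absurd h (Nat.not_odd_iff_even.2 ⟨i + 1, by ring⟩)
  rw [and_iff_left h0]
  refine forall₂_congr fun i hi => ?_
  have e1 : 2 * i + 1 + 2 * (rank p.1 i + 1) - 3 = 2 * (i + rank p.1 i) := by omega
  have e2 : 2 * i + 1 + 2 * (rank p.1 i + 1) - 1 = 2 * (i + rank p.1 i) + 2 := by omega
  rw [card_filter_odd hi, e1, e2, even_mem_toParts, forall_prop_of_true ⟨i, rfl⟩]
  constructor
  · rintro ⟨h1, h2⟩ e he
    refine ⟨fun h => h2 (h ▸ he), fun h => h1 ?_⟩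
    rw [← h, mul_add]
    exact even_mem_toParts.2 he
  · intro h
    refine ⟨fun h1 => ?_, fun h2 => (h _ h2).1 rfl⟩
    rcases mem_toParts.1 h1 with ⟨j, -, hj⟩ | ⟨e, he, hj⟩
    · omega
    · exact (h e he).2 (by omega)

theorem forbidden_odd_iff_condD (p : Finset ℕ × Finset ℕ) :
    (∀ x ∈ toParts p, Even x →
      x + 2 * ((toParts p).filter (fun y => Even y ∧ y ≤ x)).card - 3 ∉ toParts p ∧
      x + 2 * ((toParts p).filter (fun y => Even y ∧ y ≤ x)).card - 1 ∉ toParts p) ↔ CondD p := by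
  rw [forall_mem_toParts, CondD]
  have h0 : (∀ i ∈ p.1, Even (2 * i + 1) →
      2 * i + 1 + 2 * ((toParts p).filter (fun y => Even y ∧ y ≤ 2 * i + 1)).card - 3 ∉
        toParts p ∧
      2 * i + 1 + 2 * ((toParts p).filter (fun y => Even y ∧ y ≤ 2 * i + 1)).card - 1 ∉
        toParts p) :=
    fun i _ h => absurd h (Nat.not_even_iff_odd.2 ⟨i, rfl⟩)
  rw [and_iff_right h0]
  refine forall₂_congr fun i hi => ?_
  have e1 : 2 * i + 2 + 2 * (rank p.2 i + 1) - 3 = 2 * (i + rank p.2 i) + 1 := by omega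
  have e2 : 2 * i + 2 + 2 * (rank p.2 i + 1) - 1 = 2 * (i + rank p.2 i + 1) + 1 := by omega
  rw [card_filter_even hi, e1, e2, odd_mem_toParts, odd_mem_toParts,
    forall_prop_of_true ⟨i + 1, by ring⟩]
  constructor
  · rintro ⟨h1, h2⟩ o ho
    exact ⟨fun h => h1 (h ▸ ho), fun h => h2 (h ▸ ho)⟩
  · exact fun h => ⟨fun h1 => (h _ h1).1 rfl, fun h2 => (h _ h2).2 rfl⟩

end Counting

end RogersRamanujan

/-- the counts `A(n)`, `B(n)`, `C(n)`, `D(n)` associated with the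
first Rogers–Ramanujan identity all coincide.  Here, for `x` the `j`-th odd
(resp. even) part of a distinct-part partition listed in ascending order,
`j` is realized as the number of odd (resp. even) parts `≤ x`. -/
theorem rogers_ramanujan_one_four_ways (n : ℕ) (hn : 0 < n) :
    -- A(n): distinct parts with a gap of at least 2 between consecutive parts
    (Nat.card {p : Nat.Partition n // p.parts.Nodup ∧
        ∀ x ∈ p.parts, ∀ y ∈ p.parts, x < y → x + 2 ≤ y} =
      -- B(n): parts ≡ 1, 4 (mod 5)
      Nat.card {p : Nat.Partition n // ∀ x ∈ p.parts, x % 5 = 1 ∨ x % 5 = 4}) ∧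
    -- B(n) = C(n)
    (Nat.card {p : Nat.Partition n // ∀ x ∈ p.parts, x % 5 = 1 ∨ x % 5 = 4} =
      Nat.card {p : Nat.Partition n // p.parts.Nodup ∧
        ∀ x ∈ p.parts, Odd x →
          x + 2 * (p.parts.filter (fun y => Odd y ∧ y ≤ x)).card - 3 ∉ p.parts ∧
          x + 2 * (p.parts.filter (fun y => Odd y ∧ y ≤ x)).card - 1 ∉ p.parts}) ∧
    -- C(n) = D(n)
    (Nat.card {p : Nat.Partition n // p.parts.Nodup ∧
        ∀ x ∈ p.parts, Odd x →
          x + 2 * (p.parts.filter (fun y => Odd y ∧ y ≤ x)).card - 3 ∉ p.parts ∧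
          x + 2 * (p.parts.filter (fun y => Odd y ∧ y ≤ x)).card - 1 ∉ p.parts} =
      Nat.card {p : Nat.Partition n // p.parts.Nodup ∧
        ∀ x ∈ p.parts, Even x →
          x + 2 * (p.parts.filter (fun y => Even y ∧ y ≤ x)).card - 3 ∉ p.parts ∧
          x + 2 * (p.parts.filter (fun y => Even y ∧ y ≤ x)).card - 1 ∉ p.parts}) := by
  have hA := RogersRamanujan.card_partition_eq_card_restricted
    (Pm := fun m => ∀ x ∈ m, ∀ y ∈ m, x < y → x + 2 ≤ y)
    RogersRamanujan.gap_iff_condA RogersRamanujan.gf_condA n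
  have hC := RogersRamanujan.card_partition_eq_card_restricted
    (Pm := fun m => ∀ x ∈ m, Odd x →
      x + 2 * (m.filter (fun y => Odd y ∧ y ≤ x)).card - 3 ∉ m ∧
      x + 2 * (m.filter (fun y => Odd y ∧ y ≤ x)).card - 1 ∉ m)
    RogersRamanujan.forbidden_even_iff_condC RogersRamanujan.gf_condC n
  have hD := RogersRamanujan.card_partition_eq_card_restricted
    (Pm := fun m => ∀ x ∈ m, Even x →
      x + 2 * (m.filter (fun y => Even y ∧ y ≤ x)).card - 3 ∉ m ∧
      x + 2 * (m.filter (fun y => Even y ∧ y ≤ x)).card - 1 ∉ m)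
    RogersRamanujan.forbidden_odd_iff_condD RogersRamanujan.gf_condD n
  exact ⟨hA, hC.symm, hC.trans hD.symm⟩
end
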